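/- arXiv:1701.01981 — 2 statements merged into one kernel-verified Lean document; each statement's English description precedes it below -/
import Mathlib

section
/- (Privacy exponent.) Let {(X_i,Y_i)}_{i∈ℕ} be a discrete-time stochastic process with finite alphabet 𝒳×𝒴 whose conditional Rényi entropy rate H = lim_{n→∞} H_{1/(1+ρ)}(X^n|Y^n)/n exists. For every positive rate pair (R₁,R₂): if R₁ + R₂ > H, then the privacy exponent equals ρ·min(R₁, R₂, H); if R₁ + R₂ < H, then the privacy exponent is −∞. This holds both when Bob's ambiguity 𝒜_B is the guessing ambiguity 𝒜_B^g and when it is the list ambiguity 𝒜_B^l. -/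
open scoped BigOperators

noncomputable section

/-- `G` is a guessing function for `X` given side information in `V`:
for every `v`, `G v` is a bijection from `X` onto `{1, …, |X|}`. -/
def IsGuess {X V : Type*} [Fintype X] (G : V → X → ℕ) : Prop :=
  ∀ v : V, Set.BijOn (G v) Set.univ (Set.Icc 1 (Fintype.card X))

/-- The conditional Rényi entropy `H_α(X|Y)` (base 2) of order `α = 1/(1+ρ)`. -/
def condRenyi {X Y : Type*} [Fintype X] [Fintype Y] (ρ : ℝ) (p : X → Y → ℝ) : ℝ :=
  ((1 / (1 + ρ)) / (1 - 1 / (1 + ρ))) *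
    Real.logb 2 (∑ y : Y, (∑ x : X, p x y ^ (1 / (1 + ρ))) ^ (1 / (1 / (1 + ρ))))

/-- Bob's guessing ambiguity `𝒜_B^g`: the least ρ-th moment of the number of guesses that
Bob, observing `(Y, M₁, M₂)`, needs to guess `X`. -/
def bobGuessAmb {𝒳 𝒴 M₁ M₂ : Type*} [Fintype 𝒳] [Fintype 𝒴] [Fintype M₁] [Fintype M₂]
    (ρ : ℝ) (p : 𝒳 → 𝒴 → ℝ) (e : 𝒳 → 𝒴 → M₁ × M₂ → ℝ) : ℝ :=
  sInf {r : ℝ | ∃ G : 𝒴 × M₁ × M₂ → 𝒳 → ℕ, IsGuess G ∧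
    r = ∑ x : 𝒳, ∑ y : 𝒴, ∑ m : M₁ × M₂, p x y * e x y m * (G (y, m) x : ℝ) ^ ρ}

/-- Bob's list ambiguity `𝒜_B^l`: the ρ-th moment of the size of the list of realizations
of `X` with positive posterior probability given `(Y, M₁, M₂)`. -/
def bobListAmb {𝒳 𝒴 M₁ M₂ : Type*} [Fintype 𝒳] [Fintype 𝒴] [Fintype M₁] [Fintype M₂]
    (ρ : ℝ) (p : 𝒳 → 𝒴 → ℝ) (e : 𝒳 → 𝒴 → M₁ × M₂ → ℝ) : ℝ :=
  ∑ x : 𝒳, ∑ y : 𝒴, ∑ m : M₁ × M₂, p x y * e x y m *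
    (((Finset.univ.filter fun x' : 𝒳 => 0 < p x' y * e x' y m).card : ℝ)) ^ ρ

/-- Eve's ambiguity `𝒜_E`: the least ρ-th moment of the number of guesses, where for every
realization the more informative of the two hints is used. -/
def eveAmb {𝒳 𝒴 M₁ M₂ : Type*} [Fintype 𝒳] [Fintype 𝒴] [Fintype M₁] [Fintype M₂]
    (ρ : ℝ) (p : 𝒳 → 𝒴 → ℝ) (e : 𝒳 → 𝒴 → M₁ × M₂ → ℝ) : ℝ :=
  sInf {r : ℝ | ∃ G₁ : 𝒴 × M₁ → 𝒳 → ℕ, ∃ G₂ : 𝒴 × M₂ → 𝒳 → ℕ, IsGuess G₁ ∧ IsGuess G₂ ∧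
    r = ∑ x : 𝒳, ∑ y : 𝒴, ∑ m₁ : M₁, ∑ m₂ : M₂, p x y * e x y (m₁, m₂) *
      ((min (G₁ (y, m₁) x) (G₂ (y, m₂) x) : ℕ) : ℝ) ^ ρ}

/-- The alternative (less conservative) Eve ambiguity `Ã_E`. -/
def eveAmbAlt {𝒳 𝒴 M₁ M₂ : Type*} [Fintype 𝒳] [Fintype 𝒴] [Fintype M₁] [Fintype M₂]
    (ρ : ℝ) (p : 𝒳 → 𝒴 → ℝ) (e : 𝒳 → 𝒴 → M₁ × M₂ → ℝ) : ℝ :=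
  min
    (sInf {r : ℝ | ∃ G₁ : 𝒴 × M₁ → 𝒳 → ℕ, IsGuess G₁ ∧
      r = ∑ x : 𝒳, ∑ y : 𝒴, ∑ m₁ : M₁, ∑ m₂ : M₂, p x y * e x y (m₁, m₂) *
        (G₁ (y, m₁) x : ℝ) ^ ρ})
    (sInf {r : ℝ | ∃ G₂ : 𝒴 × M₂ → 𝒳 → ℕ, IsGuess G₂ ∧
      r = ∑ x : 𝒳, ∑ y : 𝒴, ∑ m₁ : M₁, ∑ m₂ : M₂, p x y * e x y (m₁, m₂) *
        (G₂ (y, m₂) x : ℝ) ^ ρ})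

theorem exists_guess_le_card {X β : Type*} [Fintype X] [LinearOrder β] (f : X → β) :
    ∃ G : X → ℕ, Set.BijOn G Set.univ (Set.Icc 1 (Fintype.card X)) ∧
      ∀ x, G x ≤ (Finset.univ.filter fun x' => f x' ≤ f x).card := by
  classical
  set N := Fintype.card X
  let e : X ≃ Fin N := Fintype.equivFin X
  let s : Equiv.Perm (Fin N) := Tuple.sort (f ∘ e.symm)
  have hs : Monotone ((f ∘ e.symm) ∘ s) := Tuple.monotone_sort _
  have hval : ∀ i : Fin N, f (e.symm (s i)) = ((f ∘ e.symm) ∘ s) i := fun _ => rfl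
  refine ⟨fun x => (s.symm (e x) : ℕ) + 1, ⟨?_, ?_, ?_⟩, ?_⟩
  · intro x _
    exact ⟨Nat.le_add_left 1 _, (s.symm (e x)).isLt⟩
  · intro x _ x' _ h
    simpa [Fin.val_inj] using h
  · rintro k ⟨hk1, hk2⟩
    refine ⟨e.symm (s ⟨k - 1, by omega⟩), trivial, ?_⟩
    simp
    omega
  · intro x
    have h : (Finset.univ.image fun i : Fin ((s.symm (e x) : ℕ) + 1) =>
        e.symm (s ⟨i, by have := (s.symm (e x)).isLt; omega⟩)) ⊆
        Finset.univ.filter fun x' => f x' ≤ f x := by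
      intro x' hx'
      obtain ⟨i, -, rfl⟩ := Finset.mem_image.1 hx'
      simp only [Finset.mem_filter, Finset.mem_univ, true_and]
      have hx : f x = ((f ∘ e.symm) ∘ s) (s.symm (e x)) := by simp
      rw [hx, hval]
      exact hs (Fin.le_def.2 (by have := i.isLt; simp only; omega))
    refine le_trans (le_of_eq ?_) (Finset.card_le_card h)
    rw [Finset.card_image_of_injective]
    · simp
    · intro i j hij
      simpa [Fin.ext_iff] using hij

theorem exists_isGuess_le_card {X V β : Type*} [Fintype X] [LinearOrder β] (f : V → X → β) :
    ∃ G : V → X → ℕ, IsGuess G ∧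
      ∀ v x, G v x ≤ (Finset.univ.filter fun x' => f v x' ≤ f v x).card := by
  choose G hG using fun v => exists_guess_le_card (f v)
  exact ⟨G, fun v => (hG v).1, fun v => (hG v).2⟩

theorem exists_isGuess (X V : Type*) [Fintype X] : ∃ G : V → X → ℕ, IsGuess G :=
  (exists_isGuess_le_card fun (_ : V) (_ : X) => (0 : ℕ)).imp fun _ h => h.1

theorem IsGuess.one_le {X V : Type*} [Fintype X] {G : V → X → ℕ} (hG : IsGuess G) (v : V)
    (x : X) : 1 ≤ G v x :=
  ((hG v).mapsTo (Set.mem_univ x)).1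

theorem IsGuess.card_le {X V : Type*} [Fintype X] {G : V → X → ℕ} (hG : IsGuess G) (v : V)
    (k : ℕ) : (Finset.univ.filter fun x => G v x ≤ k).card ≤ k := by
  calc _ ≤ (Finset.Icc 1 k).card := by
        refine Finset.card_le_card_of_injOn (G v) ?_ ?_
        · intro x hx
          have h : G v x ≤ k := by simpa using hx
          simpa using ⟨hG.one_le v x, h⟩
        · exact (hG v).injOn.mono (Set.subset_univ _)
    _ = k := by simp

theorem IsGuess.sum_inv_le {X V : Type*} [Fintype X] {G : V → X → ℕ} (hG : IsGuess G) (v : V) :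
    ∑ x, ((G v x : ℕ) : ℝ)⁻¹ ≤ 1 + Real.log (Fintype.card X) := by
  classical
  have himg : Finset.univ.image (G v) = Finset.Icc 1 (Fintype.card X) := by
    apply Finset.coe_injective
    simpa using (hG v).image_eq
  have h := harmonic_le_one_add_log (Fintype.card X)
  rw [harmonic_eq_sum_Icc, ← himg, Finset.sum_image ((hG v).injOn.mono (Set.subset_univ _))] at h
  push_cast at h
  exact h

theorem sum_rpow_le_mul_sum {ι : Type*} [Fintype ι] {ρ : ℝ} (hρ : 0 < ρ) {q g : ι → ℝ}
    (hq : ∀ i, 0 ≤ q i) (hg : ∀ i, 0 < g i) :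
    (∑ i, q i ^ (1 / (1 + ρ))) ^ (1 + ρ) ≤ (∑ i, (g i)⁻¹) ^ ρ * ∑ i, q i * g i ^ ρ := by
  have h1 : (0 : ℝ) < 1 + ρ := by linarith
  have hpq : (1 + ρ).HolderConjugate ((1 + ρ) / ρ) := by
    rw [Real.holderConjugate_iff]
    refine ⟨by linarith, ?_⟩
    field_simp
  have hA : ∀ i, 0 ≤ q i * g i ^ ρ := fun i => mul_nonneg (hq i) (Real.rpow_nonneg (hg i).le _)
  have key := Real.inner_le_Lp_mul_Lq Finset.univ
    (fun i => (q i * g i ^ ρ) ^ (1 / (1 + ρ))) (fun i => ((g i)⁻¹) ^ (ρ / (1 + ρ))) hpq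
  have e1 : ∀ i, (q i * g i ^ ρ) ^ (1 / (1 + ρ)) * ((g i)⁻¹) ^ (ρ / (1 + ρ)) =
      q i ^ (1 / (1 + ρ)) := by
    intro i
    rw [Real.mul_rpow (hq i) (Real.rpow_nonneg (hg i).le _), ← Real.rpow_mul (hg i).le,
      Real.inv_rpow (hg i).le, mul_one_div, mul_assoc, mul_inv_cancel₀, mul_one]
    exact (Real.rpow_pos_of_pos (hg i) _).ne'
  have e2 : ∀ i, |(q i * g i ^ ρ) ^ (1 / (1 + ρ))| ^ (1 + ρ) = q i * g i ^ ρ := by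
    intro i
    rw [abs_of_nonneg (Real.rpow_nonneg (hA i) _), ← Real.rpow_mul (hA i),
      one_div_mul_cancel h1.ne', Real.rpow_one]
  have e3 : ∀ i, |((g i)⁻¹) ^ (ρ / (1 + ρ))| ^ ((1 + ρ) / ρ) = (g i)⁻¹ := by
    intro i
    have hi : 0 ≤ (g i)⁻¹ := (inv_pos.2 (hg i)).le
    rw [abs_of_nonneg (Real.rpow_nonneg hi _), ← Real.rpow_mul hi]
    have : ρ / (1 + ρ) * ((1 + ρ) / ρ) = 1 := by field_simp
    rw [this, Real.rpow_one]
  simp only [e1, e2, e3] at key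
  have hS1 : 0 ≤ ∑ i, q i * g i ^ ρ := Finset.sum_nonneg fun i _ => hA i
  have hS2 : 0 ≤ ∑ i, (g i)⁻¹ := Finset.sum_nonneg fun i _ => (inv_pos.2 (hg i)).le
  have hS0 : 0 ≤ ∑ i, q i ^ (1 / (1 + ρ)) :=
    Finset.sum_nonneg fun i _ => Real.rpow_nonneg (hq i) _
  calc _ ≤ _ := Real.rpow_le_rpow hS0 key h1.le
    _ = _ := by
      rw [Real.mul_rpow (Real.rpow_nonneg hS1 _) (Real.rpow_nonneg hS2 _), ← Real.rpow_mul hS1,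
        ← Real.rpow_mul hS2, one_div_mul_cancel h1.ne', Real.rpow_one]
      have : 1 / ((1 + ρ) / ρ) * (1 + ρ) = ρ := by field_simp
      rw [this, mul_comm]

theorem exists_isGuess_sum_le {X V : Type*} [Fintype X] {ρ : ℝ} (hρ : 0 < ρ) {q : V → X → ℝ}
    (hq : ∀ v x, 0 ≤ q v x) :
    ∃ G : V → X → ℕ, IsGuess G ∧
      ∀ v, ∑ x, q v x * (G v x : ℝ) ^ ρ ≤ (∑ x, q v x ^ (1 / (1 + ρ))) ^ (1 + ρ) := by
  obtain ⟨G, hG, hle⟩ := exists_isGuess_le_card (fun v x => -q v x)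
  refine ⟨G, hG, fun v => ?_⟩
  have h1 : (0 : ℝ) < 1 + ρ := by linarith
  set T := ∑ x, q v x ^ (1 / (1 + ρ)) with hT
  have hT0 : 0 ≤ T := Finset.sum_nonneg fun x _ => Real.rpow_nonneg (hq v x) _
  have hterm : ∀ x, q v x * (G v x : ℝ) ^ ρ ≤ q v x ^ (1 / (1 + ρ)) * T ^ ρ := by
    intro x
    rcases (hq v x).eq_or_lt with h0 | h0
    · rw [← h0]
      simp only [zero_mul]
      exact mul_nonneg (Real.rpow_nonneg le_rfl _) (Real.rpow_nonneg hT0 _)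
    have hpos : 0 < q v x ^ (1 / (1 + ρ)) := Real.rpow_pos_of_pos h0 _
    have hb : (G v x : ℝ) * q v x ^ (1 / (1 + ρ)) ≤ T := by
      calc (G v x : ℝ) * q v x ^ (1 / (1 + ρ))
          ≤ ((Finset.univ.filter fun x' => -q v x' ≤ -q v x).card : ℝ) *
              q v x ^ (1 / (1 + ρ)) := by
            gcongr
            exact hle v x
        _ = ∑ _x' ∈ Finset.univ.filter fun x' => -q v x' ≤ -q v x, q v x ^ (1 / (1 + ρ)) := by
            rw [Finset.sum_const, nsmul_eq_mul]
        _ ≤ ∑ x' ∈ Finset.univ.filter fun x' => -q v x' ≤ -q v x, q v x' ^ (1 / (1 + ρ)) := by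
            refine Finset.sum_le_sum fun x' hx' => ?_
            have : q v x ≤ q v x' := by simpa using hx'
            exact Real.rpow_le_rpow h0.le this (by positivity)
        _ ≤ T := Finset.sum_le_sum_of_subset_of_nonneg (Finset.filter_subset _ _)
            fun x' _ _ => Real.rpow_nonneg (hq v x') _
    have hsplit : q v x = q v x ^ (1 / (1 + ρ)) * (q v x ^ (1 / (1 + ρ))) ^ ρ := by
      rw [← Real.rpow_mul h0.le, ← Real.rpow_add h0]
      have : 1 / (1 + ρ) + 1 / (1 + ρ) * ρ = 1 := by field_simp
      rw [this, Real.rpow_one]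
    calc q v x * (G v x : ℝ) ^ ρ
        = q v x ^ (1 / (1 + ρ)) * ((G v x : ℝ) * q v x ^ (1 / (1 + ρ))) ^ ρ := by
          rw [Real.mul_rpow (by positivity) hpos.le]
          conv_lhs => rw [hsplit]
          ring
      _ ≤ _ := by gcongr
  calc _ ≤ ∑ x, q v x ^ (1 / (1 + ρ)) * T ^ ρ := Finset.sum_le_sum fun x _ => hterm x
    _ = T * T ^ ρ := by rw [← Finset.sum_mul]
    _ = T ^ (1 + ρ) := by
      rcases hT0.eq_or_lt with h0 | h0
      · rw [← h0, Real.zero_rpow h1.ne', zero_mul]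
      · rw [Real.rpow_add h0, Real.rpow_one]

/-- The list-size code: `c x` records the dyadic scale of the rank of `x` and the rank mod `N`. -/
theorem exists_code_sum_le {X : Type*} [Fintype X] {ρ : ℝ} (hρ : 0 < ρ) {q : X → ℝ}
    (hq : ∀ x, 0 ≤ q x) {N : ℕ} (hN : 0 < N) :
    ∃ c : X → Fin (Nat.log 2 (Fintype.card X) + 1) × Fin N,
      ∑ x, q x * ((Finset.univ.filter fun x' => c x' = c x).card : ℝ) ^ ρ ≤
        ∑ x, q x + (2 / N) ^ ρ * (∑ x, q x ^ (1 / (1 + ρ))) ^ (1 + ρ) := by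
  obtain ⟨G, hG, hsum⟩ := exists_isGuess_sum_le (V := Unit) hρ (q := fun _ => q) fun _ => hq
  specialize hsum ()
  have hGle : ∀ x, G () x ≤ Fintype.card X := fun x => ((hG ()).mapsTo (Set.mem_univ x)).2
  let c : X → Fin (Nat.log 2 (Fintype.card X) + 1) × Fin N := fun x =>
    (⟨Nat.log 2 (G () x), Nat.lt_succ_of_le (Nat.log_mono_right (hGle x))⟩,
      ⟨G () x % N, Nat.mod_lt _ hN⟩)
  have hN' : (0 : ℝ) < N := by exact_mod_cast hN
  refine ⟨c, ?_⟩
  have hcard : ∀ x, (Finset.univ.filter fun x' => c x' = c x).card ≤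
      (2 ^ Nat.log 2 (G () x) - 1) / N + 1 := by
    intro x
    set i := Nat.log 2 (G () x)
    have hmaps : ∀ x', c x' = c x → 2 ^ i ≤ G () x' ∧ G () x' < 2 ^ (i + 1) ∧
        G () x' % N = G () x % N := by
      intro x' h
      have h1 : Nat.log 2 (G () x') = i := congrArg (fun z => (z.1 : ℕ)) h
      have h2 : G () x' % N = G () x % N := congrArg (fun z => (z.2 : ℕ)) h
      have h3 : G () x' ≠ 0 := by have := hG.one_le () x'; omega
      exact ⟨h1 ▸ Nat.pow_log_le_self 2 h3, h1 ▸ Nat.lt_pow_succ_log_self (by norm_num) _, h2⟩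
    have hcongr : ∀ x', c x' = c x → ∀ x'', c x'' = c x →
        (G () x' - 2 ^ i) / N = (G () x'' - 2 ^ i) / N → x' = x'' := by
      intro x' h' x'' h'' h
      obtain ⟨a1, a2, a3⟩ := hmaps x' h'
      obtain ⟨b1, b2, b3⟩ := hmaps x'' h''
      refine (hG ()).injOn (Set.mem_univ _) (Set.mem_univ _) ?_
      have hmod : (G () x' - 2 ^ i) ≡ (G () x'' - 2 ^ i) [MOD N] := by
        have hm : G () x' ≡ G () x'' [MOD N] := a3.trans b3.symm
        apply Nat.ModEq.add_right_cancel' (2 ^ i)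
        rwa [Nat.sub_add_cancel a1, Nat.sub_add_cancel b1]
      have e1 := Nat.div_add_mod (G () x' - 2 ^ i) N
      have e2 := Nat.div_add_mod (G () x'' - 2 ^ i) N
      rw [h, hmod] at e1
      omega
    calc _ ≤ (Finset.range ((2 ^ i - 1) / N + 1)).card := by
          refine Finset.card_le_card_of_injOn (fun x' => (G () x' - 2 ^ i) / N) ?_ ?_
          · intro x' hx'
            obtain ⟨a1, a2, a3⟩ := hmaps x' (by simpa using hx')
            simp only [Finset.coe_range, Set.mem_Iio]
            refine Nat.lt_succ_of_le (Nat.div_le_div_right ?_)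
            rw [pow_succ] at a2
            omega
          · intro x' hx' x'' hx'' h
            exact hcongr x' (by simpa using hx') x'' (by simpa using hx'') h
      _ = _ := Finset.card_range _
  have hreal : ∀ x, ((Finset.univ.filter fun x' => c x' = c x).card : ℝ) ^ ρ ≤
      1 + (2 / N) ^ ρ * (G () x : ℝ) ^ ρ := by
    intro x
    have h3 : G () x ≠ 0 := by have := hG.one_le () x; omega
    have hp := Nat.pow_log_le_self 2 h3
    set v := (2 ^ Nat.log 2 (G () x) - 1) / N with hv
    have hvN : v * N ≤ G () x := (Nat.div_mul_le_self _ _).trans (by omega)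
    have hc : ((Finset.univ.filter fun x' => c x' = c x).card : ℝ) ≤ v + 1 := by
      exact_mod_cast hcard x
    have hnn : 0 ≤ (2 / (N : ℝ)) ^ ρ * (G () x : ℝ) ^ ρ := by positivity
    rcases Nat.eq_zero_or_pos v with h0 | h0
    · rw [h0] at hc
      have : ((Finset.univ.filter fun x' => c x' = c x).card : ℝ) ^ ρ ≤ 1 :=
        Real.rpow_le_one (by positivity) (by simpa using hc) hρ.le
      linarith
    · have hv1 : (1 : ℝ) ≤ v := by exact_mod_cast h0
      have hvr : (v : ℝ) ≤ G () x / N := by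
        rw [le_div_iff₀ hN']
        exact_mod_cast hvN
      have : ((Finset.univ.filter fun x' => c x' = c x).card : ℝ) ^ ρ ≤
          (2 / N * (G () x : ℝ)) ^ ρ := by
        refine Real.rpow_le_rpow (by positivity) ?_ hρ.le
        calc _ ≤ 2 * (v : ℝ) := by linarith
          _ ≤ 2 * (G () x / N) := by gcongr
          _ = _ := by ring
      rw [Real.mul_rpow (by positivity) (by positivity)] at this
      linarith
  calc _ ≤ ∑ x, (q x + (2 / N) ^ ρ * (q x * (G () x : ℝ) ^ ρ)) := by
        refine Finset.sum_le_sum fun x _ => ?_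
        calc _ ≤ q x * (1 + (2 / N) ^ ρ * (G () x : ℝ) ^ ρ) :=
              mul_le_mul_of_nonneg_left (hreal x) (hq x)
          _ = _ := by ring
    _ = ∑ x, q x + (2 / N) ^ ρ * ∑ x, q x * (G () x : ℝ) ^ ρ := by
        rw [Finset.sum_add_distrib, Finset.mul_sum]
    _ ≤ _ := by gcongr

/-- The quantity `2 ^ (ρ * H_α(X|Y))` with `α = 1/(1+ρ)`. -/
def renyiSum {X Y : Type*} [Fintype X] [Fintype Y] (ρ : ℝ) (p : X → Y → ℝ) : ℝ :=
  ∑ y, (∑ x, p x y ^ (1 / (1 + ρ))) ^ (1 + ρ)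

theorem mul_condRenyi {X Y : Type*} [Fintype X] [Fintype Y] {ρ : ℝ} (hρ : 0 < ρ)
    (p : X → Y → ℝ) : ρ * condRenyi ρ p = Real.logb 2 (renyiSum ρ p) := by
  have h : (1 / (1 + ρ)) / (1 - 1 / (1 + ρ)) = 1 / ρ := by
    have : 1 - 1 / (1 + ρ) = ρ / (1 + ρ) := by field_simp; ring
    rw [this]
    field_simp
  unfold condRenyi renyiSum
  rw [h, one_div_one_div, ← mul_assoc, mul_one_div_cancel hρ.ne', one_mul]

section OneShot

variable {X Y M₁ M₂ : Type*} [Fintype X] [Fintype Y] [Fintype M₁] [Fintype M₂] {ρ : ℝ}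
  {p : X → Y → ℝ} {e : X → Y → M₁ × M₂ → ℝ}

theorem one_le_renyiSum (hρ : 0 < ρ) (hp0 : ∀ x y, 0 ≤ p x y)
    (hp1 : ∑ x, ∑ y, p x y = 1) : 1 ≤ renyiSum ρ p := by
  obtain ⟨G, hG, hsum⟩ := exists_isGuess_sum_le hρ (q := fun y x => p x y) fun y x => hp0 x y
  rw [← hp1, Finset.sum_comm]
  refine Finset.sum_le_sum fun y _ => le_trans (Finset.sum_le_sum fun x _ => ?_) (hsum y)
  refine le_mul_of_one_le_right (hp0 x y) (Real.one_le_rpow ?_ hρ.le)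
  exact_mod_cast hG.one_le y x

theorem sum_sum_mul_eq (he1 : ∀ x y, ∑ m, e x y m = 1) (f : X → Y → ℝ) :
    ∑ x, ∑ y, ∑ m, p x y * e x y m * f x y = ∑ x, ∑ y, p x y * f x y := by
  refine Finset.sum_congr rfl fun x _ => Finset.sum_congr rfl fun y _ => ?_
  rw [← Finset.sum_mul, ← Finset.mul_sum, he1, mul_one]

theorem one_le_sum (hρ : 0 < ρ) (hp0 : ∀ x y, 0 ≤ p x y)
    (hp1 : ∑ x, ∑ y, p x y = 1) (he0 : ∀ x y m, 0 ≤ e x y m) (he1 : ∀ x y, ∑ m, e x y m = 1)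
    {g : X → Y → M₁ × M₂ → ℕ} (hg : ∀ x y m, 1 ≤ g x y m) :
    1 ≤ ∑ x, ∑ y, ∑ m, p x y * e x y m * (g x y m : ℝ) ^ ρ := by
  calc (1 : ℝ) = ∑ x, ∑ y, ∑ m, p x y * e x y m * 1 := by
        rw [sum_sum_mul_eq he1 fun _ _ => 1]
        simpa using hp1.symm
    _ ≤ _ := by
        refine Finset.sum_le_sum fun x _ => Finset.sum_le_sum fun y _ =>
          Finset.sum_le_sum fun m _ => ?_
        refine mul_le_mul_of_nonneg_left (Real.one_le_rpow ?_ hρ.le)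
          (mul_nonneg (hp0 x y) (he0 x y m))
        exact_mod_cast hg x y m

theorem bobGuessAmb_le (hp0 : ∀ x y, 0 ≤ p x y) (he0 : ∀ x y m, 0 ≤ e x y m)
    {G : Y × M₁ × M₂ → X → ℕ} (hG : IsGuess G) :
    bobGuessAmb ρ p e ≤ ∑ x, ∑ y, ∑ m, p x y * e x y m * (G (y, m) x : ℝ) ^ ρ := by
  refine csInf_le ⟨0, ?_⟩ ⟨G, hG, rfl⟩
  rintro _ ⟨G', -, rfl⟩
  exact Finset.sum_nonneg fun x _ => Finset.sum_nonneg fun y _ => Finset.sum_nonneg fun m _ =>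
    mul_nonneg (mul_nonneg (hp0 x y) (he0 x y m)) (by positivity)

theorem le_bobGuessAmb {r : ℝ} (h : ∀ G : Y × M₁ × M₂ → X → ℕ, IsGuess G →
    r ≤ ∑ x, ∑ y, ∑ m, p x y * e x y m * (G (y, m) x : ℝ) ^ ρ) : r ≤ bobGuessAmb ρ p e := by
  obtain ⟨G, hG⟩ := exists_isGuess X (Y × M₁ × M₂)
  refine le_csInf ⟨_, G, hG, rfl⟩ ?_
  rintro _ ⟨G', hG', rfl⟩
  exact h G' hG'

theorem eveAmb_le (hp0 : ∀ x y, 0 ≤ p x y) (he0 : ∀ x y m, 0 ≤ e x y m)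
    {G₁ : Y × M₁ → X → ℕ} {G₂ : Y × M₂ → X → ℕ} (hG₁ : IsGuess G₁) (hG₂ : IsGuess G₂) :
    eveAmb ρ p e ≤ ∑ x, ∑ y, ∑ m : M₁ × M₂, p x y * e x y m *
      ((min (G₁ (y, m.1) x) (G₂ (y, m.2) x) : ℕ) : ℝ) ^ ρ := by
  simp only [Fintype.sum_prod_type]
  refine csInf_le ⟨0, ?_⟩ ⟨G₁, G₂, hG₁, hG₂, rfl⟩
  rintro _ ⟨G₁', G₂', -, -, rfl⟩
  exact Finset.sum_nonneg fun x _ => Finset.sum_nonneg fun y _ => Finset.sum_nonneg fun m₁ _ =>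
    Finset.sum_nonneg fun m₂ _ =>
    mul_nonneg (mul_nonneg (hp0 x y) (he0 x y (m₁, m₂))) (by positivity)

theorem le_eveAmb {r : ℝ} (h : ∀ (G₁ : Y × M₁ → X → ℕ) (G₂ : Y × M₂ → X → ℕ), IsGuess G₁ →
    IsGuess G₂ → r ≤ ∑ x, ∑ y, ∑ m : M₁ × M₂, p x y * e x y m *
      ((min (G₁ (y, m.1) x) (G₂ (y, m.2) x) : ℕ) : ℝ) ^ ρ) : r ≤ eveAmb ρ p e := by
  obtain ⟨G₁, hG₁⟩ := exists_isGuess X (Y × M₁)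
  obtain ⟨G₂, hG₂⟩ := exists_isGuess X (Y × M₂)
  refine le_csInf ⟨_, G₁, G₂, hG₁, hG₂, rfl⟩ ?_
  rintro _ ⟨G₁', G₂', hG₁', hG₂', rfl⟩
  simpa only [Fintype.sum_prod_type] using h G₁' G₂' hG₁' hG₂'

theorem one_le_bobGuessAmb (hρ : 0 < ρ) (hp0 : ∀ x y, 0 ≤ p x y)
    (hp1 : ∑ x, ∑ y, p x y = 1) (he0 : ∀ x y m, 0 ≤ e x y m) (he1 : ∀ x y, ∑ m, e x y m = 1) :
    1 ≤ bobGuessAmb ρ p e :=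
  le_bobGuessAmb fun _ hG => one_le_sum hρ hp0 hp1 he0 he1 fun _ _ _ => hG.one_le _ _

theorem one_le_eveAmb (hρ : 0 < ρ) (hp0 : ∀ x y, 0 ≤ p x y)
    (hp1 : ∑ x, ∑ y, p x y = 1) (he0 : ∀ x y m, 0 ≤ e x y m) (he1 : ∀ x y, ∑ m, e x y m = 1) :
    1 ≤ eveAmb ρ p e :=
  le_eveAmb fun _ _ hG₁ hG₂ => one_le_sum hρ hp0 hp1 he0 he1 fun _ _ _ =>
    le_min (hG₁.one_le _ _) (hG₂.one_le _ _)

theorem bobGuessAmb_le_bobListAmb (hρ : 0 < ρ) (hp0 : ∀ x y, 0 ≤ p x y)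
    (he0 : ∀ x y m, 0 ≤ e x y m) : bobGuessAmb ρ p e ≤ bobListAmb ρ p e := by
  obtain ⟨G, hG, hle⟩ := exists_isGuess_le_card (V := Y × M₁ × M₂) (X := X)
    fun v x => if 0 < p x v.1 * e x v.1 v.2 then (0 : ℕ) else 1
  refine (bobGuessAmb_le hp0 he0 hG).trans ?_
  refine Finset.sum_le_sum fun x _ => Finset.sum_le_sum fun y _ => Finset.sum_le_sum fun m _ => ?_
  rcases (mul_nonneg (hp0 x y) (he0 x y m)).eq_or_lt with h | h
  · rw [← h, zero_mul, zero_mul]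
  · refine mul_le_mul_of_nonneg_left (Real.rpow_le_rpow (by positivity) ?_ hρ.le) h.le
    have h2 := hle (y, m) x
    simp only [h, if_true] at h2
    refine le_trans (Nat.cast_le.2 h2) (Nat.cast_le.2 (Finset.card_le_card fun x' hx' => ?_))
    by_contra hc
    simp_all

theorem eveAmb_le_renyiSum (hρ : 0 < ρ) (hp0 : ∀ x y, 0 ≤ p x y) (he0 : ∀ x y m, 0 ≤ e x y m)
    (he1 : ∀ x y, ∑ m, e x y m = 1) : eveAmb ρ p e ≤ renyiSum ρ p := by
  obtain ⟨G, hG, hsum⟩ := exists_isGuess_sum_le hρ (q := fun y x => p x y) fun y x => hp0 x y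
  refine (eveAmb_le hp0 he0 (G₁ := fun v => G v.1) (G₂ := fun v => G v.1)
    (fun v => hG v.1) (fun v => hG v.1)).trans ?_
  simp only [min_self]
  rw [sum_sum_mul_eq he1 fun x y => (G y x : ℝ) ^ ρ, Finset.sum_comm]
  exact Finset.sum_le_sum fun y _ => hsum y

theorem exists_isGuess_le_mul {V M : Type*} [Fintype M] [Nonempty M]
    {G : V × M → X → ℕ} (hG : IsGuess G) :
    ∃ G' : V → X → ℕ, IsGuess G' ∧ ∀ v m x, G' v x ≤ Fintype.card M * G (v, m) x := by
  classical
  obtain ⟨G', hG', hle⟩ := exists_isGuess_le_card (V := V) (X := X)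
    fun v x => Finset.univ.inf' Finset.univ_nonempty fun m => G (v, m) x
  refine ⟨G', hG', fun v m x => (hle v x).trans ?_⟩
  calc _ ≤ (Finset.univ.biUnion fun m' : M =>
        Finset.univ.filter fun x' => G (v, m') x' ≤ G (v, m) x).card := by
        refine Finset.card_le_card fun x' hx' => ?_
        simp only [Finset.mem_filter, Finset.mem_univ, true_and] at hx'
        have h := hx'.trans (Finset.inf'_le _ (Finset.mem_univ m))
        obtain ⟨m', -, hm'⟩ := (Finset.inf'_le_iff _).1 h
        simp only [Finset.mem_biUnion, Finset.mem_univ, true_and, Finset.mem_filter]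
        exact ⟨m', hm'⟩
    _ ≤ ∑ m' : M, (Finset.univ.filter fun x' => G (v, m') x' ≤ G (v, m) x).card :=
        Finset.card_biUnion_le
    _ ≤ ∑ _m' : M, G (v, m) x := Finset.sum_le_sum fun m' _ => hG.card_le _ _
    _ = _ := by simp

theorem eveAmb_le_mul_of_le (hρ : 0 < ρ) (hp0 : ∀ x y, 0 ≤ p x y)
    (he0 : ∀ x y m, 0 ≤ e x y m) {K : ℕ} (hK : 0 < K)
    (h : ∀ G : Y × M₁ × M₂ → X → ℕ, IsGuess G → ∃ (G₁ : Y × M₁ → X → ℕ) (G₂ : Y × M₂ → X → ℕ),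
      IsGuess G₁ ∧ IsGuess G₂ ∧
        ∀ x y m, min (G₁ (y, m.1) x) (G₂ (y, m.2) x) ≤ K * G (y, m) x) :
    eveAmb ρ p e ≤ (K : ℝ) ^ ρ * bobGuessAmb ρ p e := by
  have hK' : (0 : ℝ) < (K : ℝ) ^ ρ := by positivity
  rw [← div_le_iff₀' hK']
  refine le_bobGuessAmb fun G hG => ?_
  obtain ⟨G₁, G₂, hG₁, hG₂, hle⟩ := h G hG
  rw [div_le_iff₀' hK']
  refine (eveAmb_le hp0 he0 hG₁ hG₂).trans ?_
  simp only [Finset.mul_sum]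
  refine Finset.sum_le_sum fun x _ => Finset.sum_le_sum fun y _ => Finset.sum_le_sum fun m _ => ?_
  rw [mul_left_comm, ← Real.mul_rpow (by positivity) (by positivity)]
  refine mul_le_mul_of_nonneg_left (Real.rpow_le_rpow (by positivity) ?_ hρ.le)
    (mul_nonneg (hp0 x y) (he0 x y m))
  exact_mod_cast hle x y m

theorem eveAmb_le_card_left_mul [Nonempty M₁] (hρ : 0 < ρ) (hp0 : ∀ x y, 0 ≤ p x y)
    (he0 : ∀ x y m, 0 ≤ e x y m) :
    eveAmb ρ p e ≤ (Fintype.card M₁ : ℝ) ^ ρ * bobGuessAmb ρ p e := by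
  refine eveAmb_le_mul_of_le hρ hp0 he0 Fintype.card_pos fun G hG => ?_
  obtain ⟨G₁, hG₁⟩ := exists_isGuess X (Y × M₁)
  obtain ⟨G₂, hG₂, hle⟩ := exists_isGuess_le_mul (V := Y × M₂) (M := M₁)
    (G := fun v => G (v.1.1, v.2, v.1.2)) fun v => hG _
  exact ⟨G₁, G₂, hG₁, hG₂, fun x y m => (min_le_right _ _).trans (hle (y, m.2) m.1 x)⟩

theorem eveAmb_le_card_right_mul [Nonempty M₂] (hρ : 0 < ρ) (hp0 : ∀ x y, 0 ≤ p x y)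
    (he0 : ∀ x y m, 0 ≤ e x y m) :
    eveAmb ρ p e ≤ (Fintype.card M₂ : ℝ) ^ ρ * bobGuessAmb ρ p e := by
  refine eveAmb_le_mul_of_le hρ hp0 he0 Fintype.card_pos fun G hG => ?_
  obtain ⟨G₂, hG₂⟩ := exists_isGuess X (Y × M₂)
  obtain ⟨G₁, hG₁, hle⟩ := exists_isGuess_le_mul (V := Y × M₁) (M := M₂)
    (G := fun v => G (v.1.1, v.1.2, v.2)) fun v => hG _
  exact ⟨G₁, G₂, hG₁, hG₂, fun x y m => (min_le_left _ _).trans (hle (y, m.1) m.2 x)⟩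

theorem renyiSum_le_mul_bobGuessAmb [Nonempty M₁] [Nonempty M₂] (hρ : 0 < ρ)
    (hp0 : ∀ x y, 0 ≤ p x y) (he0 : ∀ x y m, 0 ≤ e x y m) (he1 : ∀ x y, ∑ m, e x y m = 1) :
    renyiSum ρ p ≤ (Fintype.card M₁ * Fintype.card M₂ *
      (1 + Real.log (Fintype.card X))) ^ ρ * bobGuessAmb ρ p e := by
  set C : ℝ := Fintype.card M₁ * Fintype.card M₂ * (1 + Real.log (Fintype.card X)) with hC
  have hlog : 0 ≤ Real.log (Fintype.card X) := Real.log_natCast_nonneg _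
  have hC0 : 0 < C := by
    have h1 : 0 < Fintype.card M₁ := Fintype.card_pos
    have h2 : 0 < Fintype.card M₂ := Fintype.card_pos
    positivity
  have hC' : 0 < C ^ ρ := Real.rpow_pos_of_pos hC0 _
  rw [← div_le_iff₀' hC']
  refine le_bobGuessAmb fun G hG => ?_
  rw [div_le_iff₀' hC']
  choose m hm using fun (y : Y) (x : X) => Finite.exists_min fun m : M₁ × M₂ => G (y, m) x
  have hpos : ∀ y x, (0 : ℝ) < G (y, m y x) x := fun y x => by
    exact_mod_cast hG.one_le (y, m y x) x
  calc renyiSum ρ p ≤ ∑ y, C ^ ρ * ∑ x, p x y * (G (y, m y x) x : ℝ) ^ ρ := by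
        refine Finset.sum_le_sum fun y _ =>
          (sum_rpow_le_mul_sum hρ (fun x => hp0 x y) (hpos y)).trans ?_
        gcongr
        · exact Finset.sum_nonneg fun x _ => mul_nonneg (hp0 x y) (by positivity)
        calc ∑ x, ((G (y, m y x) x : ℕ) : ℝ)⁻¹ ≤ ∑ x, ∑ m', ((G (y, m') x : ℕ) : ℝ)⁻¹ :=
              Finset.sum_le_sum fun x _ => Finset.single_le_sum
                (f := fun m' => ((G (y, m') x : ℕ) : ℝ)⁻¹) (fun _ _ => by positivity)
                (Finset.mem_univ (m y x))
          _ = ∑ m', ∑ x, ((G (y, m') x : ℕ) : ℝ)⁻¹ := Finset.sum_comm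
          _ ≤ ∑ _m' : M₁ × M₂, (1 + Real.log (Fintype.card X)) :=
              Finset.sum_le_sum fun m' _ => hG.sum_inv_le _
          _ = C := by
              simp [hC]
              ring
    _ = C ^ ρ * ∑ x, ∑ y, ∑ m', p x y * e x y m' * (G (y, m y x) x : ℝ) ^ ρ := by
        rw [sum_sum_mul_eq he1 fun x y => (G (y, m y x) x : ℝ) ^ ρ, ← Finset.mul_sum,
          Finset.sum_comm]
    _ ≤ _ := by
        gcongr with x _ y _ m' _
        · exact mul_nonneg (hp0 x y) (he0 x y m')
        · exact_mod_cast hm y x m'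

/-- One-time-pad sharing of a list-size code between the two hints. -/
theorem exists_encoder (hρ : 0 < ρ) (hp0 : ∀ x y, 0 ≤ p x y) (hp1 : ∑ x, ∑ y, p x y = 1)
    {A B₁ B₂ N : ℕ} (hA : 0 < A) (hN : 0 < N) (h₁ : A * B₁ ≤ Fintype.card M₁)
    (h₂ : A * B₂ ≤ Fintype.card M₂)
    (hcode : (Nat.log 2 (Fintype.card X) + 1) * N ≤ A * B₁ * B₂) :
    ∃ e : X → Y → M₁ × M₂ → ℝ, (∀ x y m, 0 ≤ e x y m) ∧ (∀ x y, ∑ m, e x y m = 1) ∧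
      bobListAmb ρ p e ≤ 1 + (2 / N) ^ ρ * renyiSum ρ p ∧
      renyiSum ρ p ≤ ((B₁ + B₂) * (1 + Real.log (Fintype.card X))) ^ ρ * eveAmb ρ p e := by
  classical
  have : NeZero A := ⟨hA.ne'⟩
  have hA' : (0 : ℝ) < A := by exact_mod_cast hA
  obtain ⟨f₁⟩ : Nonempty (ZMod A × Fin B₁ ↪ M₁) :=
    Function.Embedding.nonempty_of_card_le (by simpa [ZMod.card] using h₁)
  obtain ⟨f₂⟩ : Nonempty (ZMod A × Fin B₂ ↪ M₂) :=
    Function.Embedding.nonempty_of_card_le (by simpa [ZMod.card] using h₂)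
  obtain ⟨f⟩ : Nonempty (Fin (Nat.log 2 (Fintype.card X) + 1) × Fin N ↪
      (ZMod A × Fin B₁) × Fin B₂) :=
    Function.Embedding.nonempty_of_card_le (by simpa [ZMod.card] using hcode)
  choose c hc using fun y => exists_code_sum_le hρ (q := fun x => p x y) (fun x => hp0 x y) hN
  let s : X → Y → (ZMod A × Fin B₁) × Fin B₂ := fun x y => f (c y x)
  let h : X → Y → ZMod A → M₁ × M₂ := fun x y k =>
    (f₁ (k, (s x y).1.2), f₂ (k + (s x y).1.1, (s x y).2))
  let e : X → Y → M₁ × M₂ → ℝ := fun x y m => ∑ k, if h x y k = m then (A : ℝ)⁻¹ else 0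
  have hinj : ∀ x x' y k k', h x y k = h x' y k' → c y x = c y x' := by
    intro x x' y k k' hk
    have h1 := f₁.injective (congrArg Prod.fst hk)
    have h2 := f₂.injective (congrArg Prod.snd hk)
    simp only [Prod.mk.injEq] at h1 h2
    obtain ⟨rfl, h1⟩ := h1
    refine f.injective (Prod.ext (Prod.ext ?_ h1) h2.2)
    exact add_left_cancel h2.1
  have hesum : ∀ x y (F : M₁ × M₂ → ℝ), ∑ m, p x y * e x y m * F m =
      ∑ k, p x y * (A : ℝ)⁻¹ * F (h x y k) := by
    intro x y F
    simp only [e, Finset.mul_sum, Finset.sum_mul]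
    rw [Finset.sum_comm]
    refine Finset.sum_congr rfl fun k _ => ?_
    rw [Finset.sum_eq_single (h x y k)]
    · simp
    · intro m _ hm
      simp [hm.symm]
    · simp
  have hesupp : ∀ x y m, 0 < e x y m → ∃ k, h x y k = m := by
    intro x y m hpos
    by_contra hne
    push Not at hne
    simp [e, hne] at hpos
  have hsumA : ∀ x y, ∑ _k : ZMod A, p x y * (A : ℝ)⁻¹ = p x y := by
    intro x y
    simp only [Finset.sum_const, Finset.card_univ, ZMod.card, nsmul_eq_mul]
    field_simp
  have he0 : ∀ x y m, 0 ≤ e x y m := fun x y m =>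
    Finset.sum_nonneg fun k _ => by split_ifs <;> positivity
  have he1 : ∀ x y, ∑ m, e x y m = 1 := by
    intro x y
    simp only [e]
    rw [Finset.sum_comm]
    simp [ZMod.card, hA'.ne']
  refine ⟨e, he0, he1, ?_, ?_⟩
  · calc bobListAmb ρ p e ≤ ∑ x, ∑ y, p x y *
          ((Finset.univ.filter fun x' => c y x' = c y x).card : ℝ) ^ ρ := by
          refine Finset.sum_le_sum fun x _ => Finset.sum_le_sum fun y _ => ?_
          rw [hesum x y fun m =>
            (((Finset.univ.filter fun x' : X => 0 < p x' y * e x' y m).card : ℝ)) ^ ρ]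
          conv_rhs => rw [← hsumA x y, Finset.sum_mul]
          refine Finset.sum_le_sum fun k _ => mul_le_mul_of_nonneg_left
            (Real.rpow_le_rpow (by positivity) ?_ hρ.le)
            (mul_nonneg (hp0 x y) (by positivity))
          refine Nat.cast_le.2 (Finset.card_le_card fun x' hx' => ?_)
          simp only [Finset.mem_filter, Finset.mem_univ, true_and] at hx' ⊢
          obtain ⟨k', hk'⟩ := hesupp x' y _ (pos_of_mul_pos_right hx' (hp0 x' y))
          exact hinj _ _ _ _ _ hk'
      _ ≤ ∑ y, (∑ x, p x y + (2 / N) ^ ρ * (∑ x, p x y ^ (1 / (1 + ρ))) ^ (1 + ρ)) := by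
          rw [Finset.sum_comm]
          exact Finset.sum_le_sum fun y _ => hc y
      _ = _ := by
          rw [Finset.sum_add_distrib, ← Finset.mul_sum, Finset.sum_comm, hp1, renyiSum]
  · set l : ℝ := 1 + Real.log (Fintype.card X) with hl
    have hl0 : 0 < l := by
      have : 0 ≤ Real.log (Fintype.card X) := Real.log_natCast_nonneg _
      positivity
    have hB : 0 < B₁ := Nat.pos_of_ne_zero fun h0 => by
      rw [h0] at hcode
      simp at hcode
      omega
    set D : ℝ := (B₁ + B₂) * l with hD
    have hB' : (0 : ℝ) < B₁ := by exact_mod_cast hB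
    have hD0 : 0 < D := by positivity
    have hD' : 0 < D ^ ρ := Real.rpow_pos_of_pos hD0 _
    rw [← div_le_iff₀' hD']
    refine le_eveAmb fun G₁ G₂ hG₁ hG₂ => ?_
    rw [div_le_iff₀' hD']
    let g : X → Y → ZMod A → ℕ := fun x y k =>
      min (G₁ (y, (h x y k).1) x) (G₂ (y, (h x y k).2) x)
    have hg : ∀ x y k, (0 : ℝ) < g x y k := fun x y k => by
      exact_mod_cast le_min (hG₁.one_le _ _) (hG₂.one_le _ _)
    have hginv : ∀ y, ∑ i : X × ZMod A, ((g i.1 y i.2 : ℕ) : ℝ)⁻¹ ≤ A * D := by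
      intro y
      calc ∑ i : X × ZMod A, ((g i.1 y i.2 : ℕ) : ℝ)⁻¹
          ≤ ∑ i : X × ZMod A, (((G₁ (y, (h i.1 y i.2).1) i.1 : ℕ) : ℝ)⁻¹ +
              ((G₂ (y, (h i.1 y i.2).2) i.1 : ℕ) : ℝ)⁻¹) := by
            refine Finset.sum_le_sum fun i _ => ?_
            have a1 : (0 : ℝ) ≤ ((G₁ (y, (h i.1 y i.2).1) i.1 : ℕ) : ℝ)⁻¹ := by positivity
            have a2 : (0 : ℝ) ≤ ((G₂ (y, (h i.1 y i.2).2) i.1 : ℕ) : ℝ)⁻¹ := by positivity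
            rcases min_choice (G₁ (y, (h i.1 y i.2).1) i.1) (G₂ (y, (h i.1 y i.2).2) i.1)
              with h' | h' <;> simp only [g, h'] <;> linarith
        _ = ∑ x, ∑ k, ((G₁ (y, f₁ (k, (s x y).1.2)) x : ℕ) : ℝ)⁻¹ +
            ∑ x, ∑ k, ((G₂ (y, f₂ (k + (s x y).1.1, (s x y).2)) x : ℕ) : ℝ)⁻¹ := by
            rw [Finset.sum_add_distrib, Fintype.sum_prod_type, Fintype.sum_prod_type]
        _ ≤ ∑ x, ∑ i : ZMod A × Fin B₁, ((G₁ (y, f₁ i) x : ℕ) : ℝ)⁻¹ +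
            ∑ x, ∑ i : ZMod A × Fin B₂, ((G₂ (y, f₂ i) x : ℕ) : ℝ)⁻¹ := by
            refine add_le_add (Finset.sum_le_sum fun x _ => ?_) (Finset.sum_le_sum fun x _ => ?_)
            · rw [Fintype.sum_prod_type]
              exact Finset.sum_le_sum fun k _ => Finset.single_le_sum
                (f := fun b => ((G₁ (y, f₁ (k, b)) x : ℕ) : ℝ)⁻¹) (fun _ _ => by positivity)
                (Finset.mem_univ _)
            · rw [Fintype.sum_prod_type]
              refine le_trans (le_of_eq (Equiv.sum_comp (Equiv.addRight (s x y).1.1)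
                fun k => ((G₂ (y, f₂ (k, (s x y).2)) x : ℕ) : ℝ)⁻¹)) ?_
              exact Finset.sum_le_sum fun k _ => Finset.single_le_sum
                (f := fun b => ((G₂ (y, f₂ (k, b)) x : ℕ) : ℝ)⁻¹) (fun _ _ => by positivity)
                (Finset.mem_univ _)
        _ = ∑ i : ZMod A × Fin B₁, ∑ x, ((G₁ (y, f₁ i) x : ℕ) : ℝ)⁻¹ +
            ∑ i : ZMod A × Fin B₂, ∑ x, ((G₂ (y, f₂ i) x : ℕ) : ℝ)⁻¹ := by
            rw [Finset.sum_comm, Finset.sum_comm (s := (Finset.univ : Finset X))]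
        _ ≤ ∑ _i : ZMod A × Fin B₁, l + ∑ _i : ZMod A × Fin B₂, l :=
            add_le_add (Finset.sum_le_sum fun i _ => hG₁.sum_inv_le _)
              (Finset.sum_le_sum fun i _ => hG₂.sum_inv_le _)
        _ = A * D := by
            simp [ZMod.card, hD]
            ring
    calc renyiSum ρ p ≤ ∑ y, D ^ ρ * ∑ x, ∑ k, p x y * (A : ℝ)⁻¹ * (g x y k : ℝ) ^ ρ := by
          refine Finset.sum_le_sum fun y _ => ?_
          have key := sum_rpow_le_mul_sum hρ (q := fun i : X × ZMod A => p i.1 y)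
            (g := fun i => (g i.1 y i.2 : ℝ)) (fun i => hp0 i.1 y) fun i => hg i.1 y i.2
          have hnn : 0 ≤ ∑ i : X × ZMod A, p i.1 y * (g i.1 y i.2 : ℝ) ^ ρ :=
            Finset.sum_nonneg fun i _ => mul_nonneg (hp0 i.1 y) (by positivity)
          have hT0 : 0 ≤ ∑ x, p x y ^ (1 / (1 + ρ)) :=
            Finset.sum_nonneg fun x _ => Real.rpow_nonneg (hp0 x y) _
          have hinv0 : 0 ≤ ∑ i : X × ZMod A, ((g i.1 y i.2 : ℕ) : ℝ)⁻¹ :=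
            Finset.sum_nonneg fun i _ => by positivity
          have key2 := key.trans (mul_le_mul_of_nonneg_right
            (Real.rpow_le_rpow hinv0 (hginv y) hρ.le) hnn)
          have hL : ∑ i : X × ZMod A, p i.1 y ^ (1 / (1 + ρ)) =
              A * ∑ x, p x y ^ (1 / (1 + ρ)) := by
            rw [Fintype.sum_prod_type]
            simp [ZMod.card, Finset.mul_sum]
          rw [hL, Real.mul_rpow hA'.le hT0, Real.mul_rpow hA'.le hD0.le,
            Real.rpow_add hA', Real.rpow_one, Fintype.sum_prod_type] at key2
          have hAρ : 0 < (A : ℝ) ^ ρ := Real.rpow_pos_of_pos hA' _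
          have hR : ∑ x, ∑ k, p x y * (A : ℝ)⁻¹ * (g x y k : ℝ) ^ ρ =
              (A : ℝ)⁻¹ * ∑ x, ∑ k, p x y * (g x y k : ℝ) ^ ρ := by
            simp only [Finset.mul_sum]
            refine Finset.sum_congr rfl fun x _ => Finset.sum_congr rfl fun k _ => by ring
          rw [hR, mul_left_comm, ← div_eq_inv_mul, le_div_iff₀' hA']
          refine le_of_mul_le_mul_left ?_ hAρ
          calc _ = _ := by ring
            _ ≤ _ := key2
            _ = _ := by ring
      _ = D ^ ρ * ∑ x, ∑ y, ∑ m : M₁ × M₂, p x y * e x y m *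
          ((min (G₁ (y, m.1) x) (G₂ (y, m.2) x) : ℕ) : ℝ) ^ ρ := by
          rw [← Finset.mul_sum, Finset.sum_comm]
          congr 1
          refine Finset.sum_congr rfl fun x _ => Finset.sum_congr rfl fun y _ => ?_
          rw [hesum x y fun m =>
            ((min (G₁ (y, m.1) x) (G₂ (y, m.2) x) : ℕ) : ℝ) ^ ρ]

end OneShot

section Asymptotics

open Filter

theorem tendsto_logb_one_add_mul_div {c : ℝ} (hc : 0 ≤ c) :
    Tendsto (fun n : ℕ => Real.logb 2 (1 + n * c) / n) atTop (nhds 0) := by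
  have h1 : Tendsto (fun n : ℕ => Real.log n / n) atTop (nhds 0) :=
    (Real.isLittleO_log_id_atTop.tendsto_div_nhds_zero).comp tendsto_natCast_atTop_atTop
  have h2 : Tendsto (fun n : ℕ => (Real.log n / n + Real.log (1 + c) / n) / Real.log 2) atTop
      (nhds 0) := by
    simpa using (h1.add (tendsto_const_div_atTop_nhds_zero_nat (Real.log (1 + c)))).div_const
      (Real.log 2)
  refine tendsto_of_tendsto_of_tendsto_of_le_of_le' tendsto_const_nhds h2 ?_ ?_
  · refine Eventually.of_forall fun n => div_nonneg (Real.logb_nonneg (by norm_num) ?_)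
      n.cast_nonneg
    have : 0 ≤ n * c := by positivity
    linarith
  · filter_upwards [eventually_ge_atTop 1] with n hn
    have hn' : (1 : ℝ) ≤ n := by exact_mod_cast hn
    have hlog2 : 0 < Real.log 2 := Real.log_pos (by norm_num)
    rw [← add_div, ← Real.log_mul (by positivity) (by positivity), Real.logb, div_right_comm]
    have : 0 ≤ n * c := by positivity
    gcongr
    nlinarith

theorem liminf_le_of_eventually_le {u v : ℕ → ℝ} {L : ℝ} (hu : ∀ n, 0 ≤ u n)
    (huv : ∀ᶠ n in atTop, u n ≤ v n) (hv : Tendsto v atTop (nhds L)) :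
    liminf u atTop ≤ L := by
  rw [← hv.liminf_eq]
  exact liminf_le_liminf huv (isBoundedUnder_of ⟨0, hu⟩) hv.isCoboundedUnder_ge

theorem le_liminf_of_eventually_le {u v w : ℕ → ℝ} {L L' : ℝ}
    (hvu : ∀ᶠ n in atTop, v n ≤ u n) (hv : Tendsto v atTop (nhds L))
    (huw : ∀ᶠ n in atTop, u n ≤ w n) (hw : Tendsto w atTop (nhds L')) :
    L ≤ liminf u atTop := by
  rw [← hv.liminf_eq]
  exact liminf_le_liminf hvu hv.isBoundedUnder_ge
    (hw.isBoundedUnder_le.mono_le huw).isCoboundedUnder_ge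

/-- The hint alphabet of rate `R` at blocklength `n`. -/
abbrev Hint (R : ℝ) (n : ℕ) : Type := Fin ⌊(2 : ℝ) ^ ((n : ℝ) * R)⌋₊

theorem one_le_two_rpow_mul {R : ℝ} (hR : 0 ≤ R) (n : ℕ) : (1 : ℝ) ≤ 2 ^ ((n : ℝ) * R) :=
  Real.one_le_rpow (by norm_num) (by positivity)

theorem floor_two_rpow_pos {R : ℝ} (hR : 0 ≤ R) (n : ℕ) : 0 < ⌊(2 : ℝ) ^ ((n : ℝ) * R)⌋₊ :=
  Nat.floor_pos.2 (one_le_two_rpow_mul hR n)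

theorem floor_two_rpow_le (R : ℝ) (n : ℕ) :
    (⌊(2 : ℝ) ^ ((n : ℝ) * R)⌋₊ : ℝ) ≤ 2 ^ ((n : ℝ) * R) :=
  Nat.floor_le (by positivity)

theorem half_two_rpow_le_floor {R : ℝ} (hR : 0 ≤ R) (n : ℕ) :
    (2 : ℝ) ^ ((n : ℝ) * R) / 2 ≤ ⌊(2 : ℝ) ^ ((n : ℝ) * R)⌋₊ := by
  have h1 := Nat.lt_floor_add_one ((2 : ℝ) ^ ((n : ℝ) * R))
  have h2 : (1 : ℝ) ≤ ⌊(2 : ℝ) ^ ((n : ℝ) * R)⌋₊ := by exact_mod_cast floor_two_rpow_pos hR n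
  linarith

theorem logb_floor_two_rpow_le {R : ℝ} (hR : 0 ≤ R) (n : ℕ) :
    Real.logb 2 ⌊(2 : ℝ) ^ ((n : ℝ) * R)⌋₊ ≤ n * R := by
  have h := Real.logb_le_logb_of_le (b := 2) (by norm_num)
    (Nat.cast_pos.2 (floor_two_rpow_pos hR n)) (floor_two_rpow_le R n)
  rwa [Real.logb_rpow (by norm_num) (by norm_num)] at h

theorem floor_two_rpow_mul_le {a b R : ℝ} (hab : a + b ≤ R) (n : ℕ) :
    ⌊(2 : ℝ) ^ ((n : ℝ) * a)⌋₊ * ⌊(2 : ℝ) ^ ((n : ℝ) * b)⌋₊ ≤ ⌊(2 : ℝ) ^ ((n : ℝ) * R)⌋₊ := by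
  refine Nat.le_floor ?_
  push_cast
  calc _ ≤ (2 : ℝ) ^ ((n : ℝ) * a) * 2 ^ ((n : ℝ) * b) := by
        gcongr <;> exact floor_two_rpow_le _ n
    _ = 2 ^ ((n : ℝ) * (a + b)) := by
        rw [← Real.rpow_add (by norm_num), mul_add]
    _ ≤ _ := Real.rpow_le_rpow_of_exponent_le (by norm_num) (by gcongr)

theorem log_card_fin_fun (𝒳 : Type*) [Fintype 𝒳] (n : ℕ) :
    Real.log (Fintype.card (Fin n → 𝒳)) = n * Real.log (Fintype.card 𝒳) := by
  simp

variable {𝒳 𝒴 : Type*} [Fintype 𝒳] [Fintype 𝒴] {ρ : ℝ}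
  {p : (n : ℕ) → (Fin n → 𝒳) → (Fin n → 𝒴) → ℝ} {H R₁ R₂ : ℝ}

theorem tendsto_logb_renyiSum_div (hρ : 0 < ρ)
    (hH : Tendsto (fun n : ℕ => condRenyi ρ (p n) / (n : ℝ)) atTop (nhds H)) :
    Tendsto (fun n : ℕ => Real.logb 2 (renyiSum ρ (p n)) / n) atTop (nhds (ρ * H)) := by
  refine (hH.const_mul ρ).congr fun n => ?_
  rw [← mul_condRenyi hρ, mul_div_assoc]

theorem tendsto_logb_div_of_tendsto_one {u : ℕ → ℝ} (hu : Tendsto u atTop (nhds 1)) :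
    Tendsto (fun n : ℕ => Real.logb 2 (u n) / n) atTop (nhds 0) := by
  have h : Tendsto (fun n => Real.logb 2 (u n)) atTop (nhds (Real.logb 2 1)) :=
    (Real.continuousAt_logb one_ne_zero).tendsto.comp hu
  exact h.div_atTop tendsto_natCast_atTop_atTop

theorem entropyRate_nonneg (hρ : 0 < ρ) (hp0 : ∀ n xs ys, 0 ≤ p n xs ys)
    (hp1 : ∀ n, ∑ xs : Fin n → 𝒳, ∑ ys : Fin n → 𝒴, p n xs ys = 1)
    (hH : Tendsto (fun n : ℕ => condRenyi ρ (p n) / (n : ℝ)) atTop (nhds H)) : 0 ≤ H := by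
  have h := ge_of_tendsto' (tendsto_logb_renyiSum_div hρ hH) (b := 0) fun n =>
    div_nonneg (Real.logb_nonneg (by norm_num) (one_le_renyiSum hρ (hp0 n) (hp1 n)))
      n.cast_nonneg
  exact nonneg_of_mul_nonneg_right h hρ

variable {e : (n : ℕ) → (Fin n → 𝒳) → (Fin n → 𝒴) → Hint R₁ n × Hint R₂ n → ℝ}

theorem tendsto_bobGuessAmb_of_bobListAmb (hρ : 0 < ρ) (hp0 : ∀ n xs ys, 0 ≤ p n xs ys)
    (hp1 : ∀ n, ∑ xs : Fin n → 𝒳, ∑ ys : Fin n → 𝒴, p n xs ys = 1)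
    (he0 : ∀ n xs ys m, 0 ≤ e n xs ys m) (he1 : ∀ n xs ys, ∑ m, e n xs ys m = 1)
    (h : Tendsto (fun n => bobListAmb ρ (p n) (e n)) atTop (nhds 1)) :
    Tendsto (fun n => bobGuessAmb ρ (p n) (e n)) atTop (nhds 1) :=
  tendsto_of_tendsto_of_tendsto_of_le_of_le tendsto_const_nhds h
    (fun n => one_le_bobGuessAmb hρ (hp0 n) (hp1 n) (he0 n) (he1 n))
    (fun n => bobGuessAmb_le_bobListAmb hρ (hp0 n) (he0 n))

theorem entropyRate_le_of_tendsto_bobGuessAmb (hρ : 0 < ρ) (hp0 : ∀ n xs ys, 0 ≤ p n xs ys)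
    (hp1 : ∀ n, ∑ xs : Fin n → 𝒳, ∑ ys : Fin n → 𝒴, p n xs ys = 1)
    (hH : Tendsto (fun n : ℕ => condRenyi ρ (p n) / (n : ℝ)) atTop (nhds H))
    (hR₁ : 0 < R₁) (hR₂ : 0 < R₂)
    (he0 : ∀ n xs ys m, 0 ≤ e n xs ys m) (he1 : ∀ n xs ys, ∑ m, e n xs ys m = 1)
    (h : Tendsto (fun n => bobGuessAmb ρ (p n) (e n)) atTop (nhds 1)) : H ≤ R₁ + R₂ := by
  set c := Real.log (Fintype.card 𝒳) with hc
  have hc0 : 0 ≤ c := Real.log_natCast_nonneg _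
  have hlim := ((tendsto_logb_one_add_mul_div hc0).const_mul ρ).add
    (tendsto_logb_div_of_tendsto_one h) |>.const_add (ρ * (R₁ + R₂))
  have hle := le_of_tendsto_of_tendsto (tendsto_logb_renyiSum_div hρ hH) hlim ?_
  · rw [mul_zero, add_zero, add_zero] at hle
    exact le_of_mul_le_mul_left hle hρ
  filter_upwards [eventually_gt_atTop 0] with n hn
  have hn' : (0 : ℝ) < n := by exact_mod_cast hn
  have i₁ : 0 < ⌊(2 : ℝ) ^ ((n : ℝ) * R₁)⌋₊ := floor_two_rpow_pos hR₁.le n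
  have i₂ : 0 < ⌊(2 : ℝ) ^ ((n : ℝ) * R₂)⌋₊ := floor_two_rpow_pos hR₂.le n
  have : Nonempty (Hint R₁ n) := ⟨⟨0, i₁⟩⟩
  have : Nonempty (Hint R₂ n) := ⟨⟨0, i₂⟩⟩
  have key := renyiSum_le_mul_bobGuessAmb hρ (hp0 n) (he0 n) (he1 n)
  have hbob := one_le_bobGuessAmb hρ (hp0 n) (hp1 n) (he0 n) (he1 n)
  have hl : 0 < 1 + n * c := by positivity
  have j₁ : (0 : ℝ) < ⌊(2 : ℝ) ^ ((n : ℝ) * R₁)⌋₊ := by exact_mod_cast i₁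
  have j₂ : (0 : ℝ) < ⌊(2 : ℝ) ^ ((n : ℝ) * R₂)⌋₊ := by exact_mod_cast i₂
  rw [log_card_fin_fun, Fintype.card_fin, Fintype.card_fin] at key
  have key2 := Real.logb_le_logb_of_le (b := 2) (by norm_num)
    (zero_lt_one.trans_le (one_le_renyiSum hρ (hp0 n) (hp1 n))) key
  rw [Real.logb_mul (by positivity) (by positivity), Real.logb_rpow_eq_mul_logb_of_pos
    (by positivity), Real.logb_mul (by positivity) (by positivity),
    Real.logb_mul (by positivity) (by positivity)] at key2
  have b₁ := logb_floor_two_rpow_le hR₁.le n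
  have b₂ := logb_floor_two_rpow_le hR₂.le n
  rw [div_le_iff₀ hn']
  calc _ ≤ _ := key2
    _ ≤ ρ * (n * R₁ + n * R₂ + Real.logb 2 (1 + n * c)) +
        Real.logb 2 (bobGuessAmb ρ (p n) (e n)) := by gcongr
    _ = _ := by
        field_simp
        ring

theorem liminf_logb_eveAmb_le (hρ : 0 < ρ) (hp0 : ∀ n xs ys, 0 ≤ p n xs ys)
    (hp1 : ∀ n, ∑ xs : Fin n → 𝒳, ∑ ys : Fin n → 𝒴, p n xs ys = 1)
    (hH : Tendsto (fun n : ℕ => condRenyi ρ (p n) / (n : ℝ)) atTop (nhds H))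
    (hR₁ : 0 < R₁) (hR₂ : 0 < R₂)
    (he0 : ∀ n xs ys m, 0 ≤ e n xs ys m) (he1 : ∀ n xs ys, ∑ m, e n xs ys m = 1)
    (h : Tendsto (fun n => bobGuessAmb ρ (p n) (e n)) atTop (nhds 1)) :
    liminf (fun n => Real.logb 2 (eveAmb ρ (p n) (e n)) / (n : ℝ)) atTop ≤
      ρ * min R₁ (min R₂ H) := by
  have hone := fun n => one_le_eveAmb hρ (hp0 n) (hp1 n) (he0 n) (he1 n)
  have hnn : ∀ n : ℕ, 0 ≤ Real.logb 2 (eveAmb ρ (p n) (e n)) / (n : ℝ) := fun n =>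
    div_nonneg (Real.logb_nonneg (by norm_num) (hone n)) n.cast_nonneg
  have hrate : ∀ R : ℝ, 0 < R → (∀ n, eveAmb ρ (p n) (e n) ≤
      (⌊(2 : ℝ) ^ ((n : ℝ) * R)⌋₊ : ℝ) ^ ρ * bobGuessAmb ρ (p n) (e n)) →
      liminf (fun n => Real.logb 2 (eveAmb ρ (p n) (e n)) / (n : ℝ)) atTop ≤ ρ * R := by
    intro R hR hle
    have hlim := (tendsto_logb_div_of_tendsto_one h).const_add (ρ * R)
    rw [add_zero] at hlim
    refine liminf_le_of_eventually_le hnn ?_ hlim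
    filter_upwards [eventually_gt_atTop 0] with n hn
    have hn' : (0 : ℝ) < n := by exact_mod_cast hn
    have hbob := one_le_bobGuessAmb hρ (hp0 n) (hp1 n) (he0 n) (he1 n)
    have j : (0 : ℝ) < ⌊(2 : ℝ) ^ ((n : ℝ) * R)⌋₊ := by
      exact_mod_cast floor_two_rpow_pos hR.le n
    have key := Real.logb_le_logb_of_le (b := 2) (by norm_num)
      (zero_lt_one.trans_le (hone n)) (hle n)
    rw [Real.logb_mul (by positivity) (by positivity), Real.logb_rpow_eq_mul_logb_of_pos j] at key
    have b := logb_floor_two_rpow_le hR.le n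
    rw [div_le_iff₀ hn']
    calc _ ≤ _ := key
      _ ≤ ρ * (n * R) + Real.logb 2 (bobGuessAmb ρ (p n) (e n)) := by gcongr
      _ = _ := by field_simp
  rw [mul_min_of_nonneg _ _ hρ.le, mul_min_of_nonneg _ _ hρ.le]
  refine le_min (hrate R₁ hR₁ fun n => ?_) (le_min (hrate R₂ hR₂ fun n => ?_) ?_)
  · have : Nonempty (Hint R₁ n) := ⟨⟨0, floor_two_rpow_pos hR₁.le n⟩⟩
    simpa using eveAmb_le_card_left_mul hρ (hp0 n) (he0 n)
  · have : Nonempty (Hint R₂ n) := ⟨⟨0, floor_two_rpow_pos hR₂.le n⟩⟩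
    simpa using eveAmb_le_card_right_mul hρ (hp0 n) (he0 n)
  · refine liminf_le_of_eventually_le hnn (Eventually.of_forall fun n => ?_)
      (tendsto_logb_renyiSum_div hρ hH)
    gcongr
    · norm_num
    · exact zero_lt_one.trans_le (hone n)
    · exact eveAmb_le_renyiSum hρ (hp0 n) (he0 n) (he1 n)

theorem eventually_code_fits (k : ℕ) {r a b₁ b₂ : ℝ} (ha : 0 ≤ a) (hb₁ : 0 ≤ b₁) (hb₂ : 0 ≤ b₂)
    (hr : r < a + b₁ + b₂) :
    ∀ᶠ n : ℕ in atTop, (Nat.log 2 (k ^ n) + 1) * ⌊(2 : ℝ) ^ ((n : ℝ) * r)⌋₊ ≤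
      ⌊(2 : ℝ) ^ ((n : ℝ) * a)⌋₊ * ⌊(2 : ℝ) ^ ((n : ℝ) * b₁)⌋₊ *
        ⌊(2 : ℝ) ^ ((n : ℝ) * b₂)⌋₊ := by
  have hc0 : 0 ≤ Real.logb 2 k := by
    rcases Nat.eq_zero_or_pos k with rfl | hk
    · simp
    · exact Real.logb_nonneg (by norm_num) (by exact_mod_cast hk)
  have hlim := (tendsto_const_div_atTop_nhds_zero_nat (3 : ℝ)).add
    (tendsto_logb_one_add_mul_div hc0)
  rw [add_zero] at hlim
  filter_upwards [hlim.eventually_lt_const (sub_pos.2 hr), eventually_gt_atTop 0] with n hlt hn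
  have hn' : (0 : ℝ) < n := by exact_mod_cast hn
  have hl : 0 < 1 + n * Real.logb 2 k := by positivity
  rw [← add_div, div_lt_iff₀ hn'] at hlt
  have hlog : (Nat.log 2 (k ^ n) : ℝ) ≤ n * Real.logb 2 k := by
    have := Real.natLog_le_logb (k ^ n) 2
    rwa [Nat.cast_pow, Real.logb_pow] at this
  have h8 : 8 * (1 + n * Real.logb 2 k) ≤ (2 : ℝ) ^ ((a + b₁ + b₂ - r) * n) := by
    calc 8 * (1 + n * Real.logb 2 k) = (2 : ℝ) ^ (3 + Real.logb 2 (1 + n * Real.logb 2 k)) := by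
          rw [Real.rpow_add (by norm_num), Real.rpow_logb (by norm_num) (by norm_num) hl]
          norm_num
      _ ≤ _ := Real.rpow_le_rpow_of_exponent_le (by norm_num) hlt.le
  have hreal : ((Nat.log 2 (k ^ n) : ℝ) + 1) * ⌊(2 : ℝ) ^ ((n : ℝ) * r)⌋₊ ≤
      ⌊(2 : ℝ) ^ ((n : ℝ) * a)⌋₊ * ⌊(2 : ℝ) ^ ((n : ℝ) * b₁)⌋₊ *
        ⌊(2 : ℝ) ^ ((n : ℝ) * b₂)⌋₊ := by
    calc _ ≤ (1 + n * Real.logb 2 k) * 2 ^ ((n : ℝ) * r) := by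
          rw [add_comm (1 : ℝ)]
          gcongr
          exact floor_two_rpow_le r n
      _ ≤ (2 : ℝ) ^ ((a + b₁ + b₂ - r) * n) / 8 * 2 ^ ((n : ℝ) * r) := by
          gcongr
          linarith
      _ = (2 : ℝ) ^ ((n : ℝ) * a) / 2 * (2 ^ ((n : ℝ) * b₁) / 2) * (2 ^ ((n : ℝ) * b₂) / 2) := by
          have e1 : (2 : ℝ) ^ ((a + b₁ + b₂ - r) * n) * 2 ^ ((n : ℝ) * r) =
              2 ^ ((n : ℝ) * a) * 2 ^ ((n : ℝ) * b₁) * 2 ^ ((n : ℝ) * b₂) := by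
            rw [← Real.rpow_add (by norm_num), ← Real.rpow_add (by norm_num),
              ← Real.rpow_add (by norm_num)]
            congr 1
            ring
          linear_combination e1 / 8
      _ ≤ _ := by
          gcongr
          · exact half_two_rpow_le_floor ha n
          · exact half_two_rpow_le_floor hb₁ n
          · exact half_two_rpow_le_floor hb₂ n
  exact_mod_cast hreal

theorem exists_encoders (hρ : 0 < ρ) (hp0 : ∀ n xs ys, 0 ≤ p n xs ys)
    (hp1 : ∀ n, ∑ xs : Fin n → 𝒳, ∑ ys : Fin n → 𝒴, p n xs ys = 1)
    (hH : Tendsto (fun n : ℕ => condRenyi ρ (p n) / (n : ℝ)) atTop (nhds H))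
    (hR₁ : 0 < R₁) (hR₂ : 0 < R₂) {δ : ℝ} (hδ : 0 < δ) (hδR : H + δ ≤ R₁ + R₂) :
    ∃ e : (n : ℕ) → (Fin n → 𝒳) → (Fin n → 𝒴) → Hint R₁ n × Hint R₂ n → ℝ,
      (∀ n xs ys m, 0 ≤ e n xs ys m) ∧ (∀ n xs ys, ∑ m, e n xs ys m = 1) ∧
      Tendsto (fun n => bobListAmb ρ (p n) (e n)) atTop (nhds 1) ∧
      ρ * (min R₁ (min R₂ H) - δ) ≤
        liminf (fun n => Real.logb 2 (eveAmb ρ (p n) (e n)) / (n : ℝ)) atTop := by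
  have hH0 : 0 ≤ H := entropyRate_nonneg hρ hp0 hp1 hH
  set r₁ := min R₁ (H + δ) with hr₁
  set r₂ := min R₂ (H + δ) with hr₂
  obtain ⟨a, ha_def⟩ : ∃ a, a = r₁ + r₂ - (H + δ) := ⟨_, rfl⟩
  obtain ⟨b₁, hb₁_def⟩ : ∃ b, b = H + δ - r₂ := ⟨_, rfl⟩
  obtain ⟨b₂, hb₂_def⟩ : ∃ b, b = H + δ - r₁ := ⟨_, rfl⟩
  have hr₁R : r₁ ≤ R₁ := min_le_left _ _
  have hr₂R : r₂ ≤ R₂ := min_le_left _ _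
  have hr₁H : r₁ ≤ H + δ := min_le_right _ _
  have hr₂H : r₂ ≤ H + δ := min_le_right _ _
  have ha : 0 ≤ a := by
    rcases min_choice R₁ (H + δ) with h1 | h1 <;> rcases min_choice R₂ (H + δ) with h2 | h2 <;>
      rw [ha_def, hr₁, hr₂, h1, h2] <;> linarith
  have hb₁ : 0 ≤ b₁ := by linarith
  have hb₂ : 0 ≤ b₂ := by linarith
  set r := H + δ / 2 with hr
  have hr0 : 0 ≤ r := by linarith
  set β := H + δ - min R₁ (min R₂ H) with hβ
  have hμ₁ : min R₁ (min R₂ H) ≤ r₁ :=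
    le_min (min_le_left _ _) (by linarith [min_le_right R₁ (min R₂ H), min_le_right R₂ H])
  have hμ₂ : min R₁ (min R₂ H) ≤ r₂ :=
    le_min (by linarith [min_le_right R₁ (min R₂ H), min_le_left R₂ H])
      (by linarith [min_le_right R₁ (min R₂ H), min_le_right R₂ H])
  have hb₁β : b₁ ≤ β := by linarith
  have hb₂β : b₂ ≤ β := by linarith
  have hex : ∀ n, ∃ e : (Fin n → 𝒳) → (Fin n → 𝒴) → Hint R₁ n × Hint R₂ n → ℝ,
      (∀ xs ys m, 0 ≤ e xs ys m) ∧ (∀ xs ys, ∑ m, e xs ys m = 1) ∧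
      ((Nat.log 2 (Fintype.card 𝒳 ^ n) + 1) * ⌊(2 : ℝ) ^ ((n : ℝ) * r)⌋₊ ≤
        ⌊(2 : ℝ) ^ ((n : ℝ) * a)⌋₊ * ⌊(2 : ℝ) ^ ((n : ℝ) * b₁)⌋₊ *
        ⌊(2 : ℝ) ^ ((n : ℝ) * b₂)⌋₊ →
      bobListAmb ρ (p n) e ≤
        1 + (2 / ⌊(2 : ℝ) ^ ((n : ℝ) * r)⌋₊) ^ ρ * renyiSum ρ (p n) ∧
      renyiSum ρ (p n) ≤ ((⌊(2 : ℝ) ^ ((n : ℝ) * b₁)⌋₊ + ⌊(2 : ℝ) ^ ((n : ℝ) * b₂)⌋₊) *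
        (1 + Real.log (Fintype.card (Fin n → 𝒳)))) ^ ρ * eveAmb ρ (p n) e) := by
    intro n
    by_cases hcode : (Nat.log 2 (Fintype.card 𝒳 ^ n) + 1) * ⌊(2 : ℝ) ^ ((n : ℝ) * r)⌋₊ ≤
        ⌊(2 : ℝ) ^ ((n : ℝ) * a)⌋₊ * ⌊(2 : ℝ) ^ ((n : ℝ) * b₁)⌋₊ *
        ⌊(2 : ℝ) ^ ((n : ℝ) * b₂)⌋₊
    · obtain ⟨e, he0, he1, hbob, heve⟩ := exists_encoder (M₁ := Hint R₁ n) (M₂ := Hint R₂ n)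
        hρ (hp0 n) (hp1 n) (floor_two_rpow_pos ha n) (floor_two_rpow_pos hr0 n)
        (B₁ := ⌊(2 : ℝ) ^ ((n : ℝ) * b₁)⌋₊) (B₂ := ⌊(2 : ℝ) ^ ((n : ℝ) * b₂)⌋₊)
        (by rw [Fintype.card_fin]; exact floor_two_rpow_mul_le (by linarith) n)
        (by rw [Fintype.card_fin]; exact floor_two_rpow_mul_le (by linarith) n)
        (by simpa using hcode)
      exact ⟨e, he0, he1, fun _ => ⟨hbob, heve⟩⟩
    · refine ⟨fun _ _ m => if m = (⟨0, floor_two_rpow_pos hR₁.le n⟩,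
        ⟨0, floor_two_rpow_pos hR₂.le n⟩) then 1 else 0, fun _ _ m => ?_, fun _ _ => ?_,
        fun h => absurd h hcode⟩
      · dsimp only
        split_ifs <;> norm_num
      · simp
  choose e he0 he1 he using hex
  have hfit := eventually_code_fits (Fintype.card 𝒳) ha hb₁ hb₂ (r := r) (by linarith)
  have hS := fun n => one_le_renyiSum hρ (hp0 n) (hp1 n)
  have hs := tendsto_logb_renyiSum_div hρ hH
  have hEve := fun n => one_le_eveAmb hρ (hp0 n) (hp1 n) (he0 n) (he1 n)
  refine ⟨e, he0, he1, ?_, ?_⟩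
  · have hexp : Tendsto (fun n : ℕ => (2 : ℝ) ^
        (2 * ρ + n * (Real.logb 2 (renyiSum ρ (p n)) / n - ρ * r))) atTop (nhds 0) := by
      have h1 : Tendsto (fun n : ℕ => (n : ℝ) * (Real.logb 2 (renyiSum ρ (p n)) / n - ρ * r))
          atTop atBot := by
        refine tendsto_natCast_atTop_atTop.atTop_mul_neg (C := ρ * H - ρ * r) ?_
          (hs.sub_const _)
        rw [hr]
        nlinarith
      exact (tendsto_rpow_atBot_of_base_gt_one 2 (by norm_num)).comp
        (tendsto_atBot_add_const_left _ _ h1)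
    have hlim := hexp.const_add 1
    rw [add_zero] at hlim
    refine tendsto_of_tendsto_of_tendsto_of_le_of_le' tendsto_const_nhds hlim
      (Eventually.of_forall fun n => (one_le_bobGuessAmb hρ (hp0 n) (hp1 n) (he0 n)
        (he1 n)).trans (bobGuessAmb_le_bobListAmb hρ (hp0 n) (he0 n))) ?_
    filter_upwards [hfit, eventually_gt_atTop 0] with n hn hn0
    have hn' : (0 : ℝ) < n := by exact_mod_cast hn0
    refine (he n hn).1.trans ?_
    have hSpos : 0 < renyiSum ρ (p n) := zero_lt_one.trans_le (hS n)
    gcongr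
    calc (2 / (⌊(2 : ℝ) ^ ((n : ℝ) * r)⌋₊ : ℝ)) ^ ρ * renyiSum ρ (p n)
        ≤ (2 / ((2 : ℝ) ^ ((n : ℝ) * r) / 2)) ^ ρ * renyiSum ρ (p n) := by
          gcongr
          exact half_two_rpow_le_floor hr0 n
      _ = ((2 : ℝ) ^ (2 - (n : ℝ) * r)) ^ ρ * 2 ^ Real.logb 2 (renyiSum ρ (p n)) := by
          rw [Real.rpow_logb (by norm_num) (by norm_num) hSpos, Real.rpow_sub (by norm_num)]
          congr 2
          norm_num
          field_simp
          norm_num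
      _ = _ := by
          rw [← Real.rpow_mul (by norm_num), ← Real.rpow_add (by norm_num)]
          congr 1
          field_simp
          ring
  · set c := Real.log (Fintype.card 𝒳) with hc
    have hc0 : 0 ≤ c := Real.log_natCast_nonneg _
    have hlim := hs.sub ((((tendsto_const_div_atTop_nhds_zero_nat (1 : ℝ)).add
      (tendsto_logb_one_add_mul_div hc0)).const_add β).const_mul ρ)
    have hval : ρ * H - ρ * (β + (0 + 0)) = ρ * (min R₁ (min R₂ H) - δ) := by
      rw [hβ]
      ring
    rw [hval] at hlim
    refine le_liminf_of_eventually_le ?_ hlim (Eventually.of_forall fun n => ?_) hs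
    · filter_upwards [hfit, eventually_gt_atTop 0] with n hn hn0
      have hn' : (0 : ℝ) < n := by exact_mod_cast hn0
      have hl : 0 < 1 + n * c := by positivity
      have key := (he n hn).2
      rw [log_card_fin_fun] at key
      have hEpos : 0 < eveAmb ρ (p n) (e n) := zero_lt_one.trans_le (hEve n)
      have hle : renyiSum ρ (p n) ≤
          (2 * 2 ^ ((n : ℝ) * β) * (1 + n * c)) ^ ρ * eveAmb ρ (p n) (e n) := by
        refine key.trans ?_
        gcongr
        have k : ∀ b ≤ β, (⌊(2 : ℝ) ^ ((n : ℝ) * b)⌋₊ : ℝ) ≤ 2 ^ ((n : ℝ) * β) := fun b hb =>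
          (floor_two_rpow_le b n).trans
            (Real.rpow_le_rpow_of_exponent_le (by norm_num) (by gcongr))
        linarith [k b₁ hb₁β, k b₂ hb₂β]
      have key2 := Real.logb_le_logb_of_le (b := 2) (by norm_num)
        (zero_lt_one.trans_le (hS n)) hle
      rw [Real.logb_mul (by positivity) (by positivity), Real.logb_rpow_eq_mul_logb_of_pos
        (by positivity), Real.logb_mul (by positivity) (by positivity),
        Real.logb_mul (by positivity) (by positivity), Real.logb_rpow (by norm_num)
        (by norm_num), Real.logb_self_eq_one (by norm_num)] at key2
      rw [le_div_iff₀ hn']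
      have hcalc : (Real.logb 2 (renyiSum ρ (p n)) / n -
          ρ * (β + (1 / n + Real.logb 2 (1 + n * c) / n))) * n =
          Real.logb 2 (renyiSum ρ (p n)) - ρ * (1 + n * β + Real.logb 2 (1 + n * c)) := by
        field_simp
        ring
      rw [hcalc]
      linarith
    · gcongr
      · norm_num
      · exact zero_lt_one.trans_le (hEve n)
      · exact eveAmb_le_renyiSum hρ (hp0 n) (he0 n) (he1 n)

end Asymptotics

/-- Theorem 7 (privacy exponent). The achievable-ambiguity-exponent set at rates `(R₁,R₂)`:
`E` is achievable if some sequence of encoders drives Bob's ambiguity to `1` while Eve's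
ambiguity grows with normalized exponent at least `E`.  If `R₁ + R₂ > H` the supremum of
this set (for either version of Bob's ambiguity) is `ρ·min(R₁, R₂, H)`; if `R₁ + R₂ < H`
the set is empty (in either version), i.e. the privacy exponent is `-∞`. -/
theorem privacy_exponent
    {𝒳 𝒴 : Type*} [Fintype 𝒳] [Fintype 𝒴]
    (ρ : ℝ) (hρ : 0 < ρ)
    (p : (n : ℕ) → (Fin n → 𝒳) → (Fin n → 𝒴) → ℝ)
    (hp0 : ∀ n xs ys, 0 ≤ p n xs ys)
    (hp1 : ∀ n, ∑ xs : Fin n → 𝒳, ∑ ys : Fin n → 𝒴, p n xs ys = 1)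
    (hproc : ∀ n (xs : Fin n → 𝒳) (ys : Fin n → 𝒴),
      p n xs ys = ∑ x : 𝒳, ∑ y : 𝒴, p (n + 1) (Fin.snoc xs x) (Fin.snoc ys y))
    (H : ℝ)
    (hH : Filter.Tendsto (fun n : ℕ => condRenyi ρ (p n) / (n : ℝ))
      Filter.atTop (nhds H))
    (R₁ R₂ : ℝ) (hR₁ : 0 < R₁) (hR₂ : 0 < R₂) :
    (R₁ + R₂ > H →
      IsLUB {E : ℝ |
          ∃ e : (n : ℕ) → (Fin n → 𝒳) → (Fin n → 𝒴) →
              Fin ⌊(2 : ℝ) ^ ((n : ℝ) * R₁)⌋₊ × Fin ⌊(2 : ℝ) ^ ((n : ℝ) * R₂)⌋₊ → ℝ,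
            (∀ n xs ys m, 0 ≤ e n xs ys m) ∧ (∀ n xs ys, ∑ m, e n xs ys m = 1) ∧
            Filter.Tendsto (fun n => bobGuessAmb ρ (p n) (e n)) Filter.atTop (nhds 1) ∧
            E ≤ Filter.liminf
              (fun n => Real.logb 2 (eveAmb ρ (p n) (e n)) / (n : ℝ)) Filter.atTop}
        (ρ * min R₁ (min R₂ H)) ∧
      IsLUB {E : ℝ |
          ∃ e : (n : ℕ) → (Fin n → 𝒳) → (Fin n → 𝒴) →
              Fin ⌊(2 : ℝ) ^ ((n : ℝ) * R₁)⌋₊ × Fin ⌊(2 : ℝ) ^ ((n : ℝ) * R₂)⌋₊ → ℝ,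
            (∀ n xs ys m, 0 ≤ e n xs ys m) ∧ (∀ n xs ys, ∑ m, e n xs ys m = 1) ∧
            Filter.Tendsto (fun n => bobListAmb ρ (p n) (e n)) Filter.atTop (nhds 1) ∧
            E ≤ Filter.liminf
              (fun n => Real.logb 2 (eveAmb ρ (p n) (e n)) / (n : ℝ)) Filter.atTop}
        (ρ * min R₁ (min R₂ H))) ∧
    (R₁ + R₂ < H →
      (¬ ∃ e : (n : ℕ) → (Fin n → 𝒳) → (Fin n → 𝒴) →
            Fin ⌊(2 : ℝ) ^ ((n : ℝ) * R₁)⌋₊ × Fin ⌊(2 : ℝ) ^ ((n : ℝ) * R₂)⌋₊ → ℝ,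
          (∀ n xs ys m, 0 ≤ e n xs ys m) ∧ (∀ n xs ys, ∑ m, e n xs ys m = 1) ∧
          Filter.Tendsto (fun n => bobGuessAmb ρ (p n) (e n)) Filter.atTop (nhds 1)) ∧
      (¬ ∃ e : (n : ℕ) → (Fin n → 𝒳) → (Fin n → 𝒴) →
            Fin ⌊(2 : ℝ) ^ ((n : ℝ) * R₁)⌋₊ × Fin ⌊(2 : ℝ) ^ ((n : ℝ) * R₂)⌋₊ → ℝ,
          (∀ n xs ys m, 0 ≤ e n xs ys m) ∧ (∀ n xs ys, ∑ m, e n xs ys m = 1) ∧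
          Filter.Tendsto (fun n => bobListAmb ρ (p n) (e n)) Filter.atTop (nhds 1))) := by
  have hub : ∀ E : ℝ, ∀ e : (n : ℕ) → (Fin n → 𝒳) → (Fin n → 𝒴) → Hint R₁ n × Hint R₂ n → ℝ,
      (∀ n xs ys m, 0 ≤ e n xs ys m) → (∀ n xs ys, ∑ m, e n xs ys m = 1) →
      Filter.Tendsto (fun n => bobGuessAmb ρ (p n) (e n)) Filter.atTop (nhds 1) →
      E ≤ Filter.liminf
        (fun n => Real.logb 2 (eveAmb ρ (p n) (e n)) / (n : ℝ)) Filter.atTop →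
      E ≤ ρ * min R₁ (min R₂ H) := fun E e he0 he1 hbob hE =>
    hE.trans (liminf_logb_eveAmb_le hρ hp0 hp1 hH hR₁ hR₂ he0 he1 hbob)
  have hsup : R₁ + R₂ > H → ∀ B : ℝ, (∀ δ, 0 < δ → H + δ ≤ R₁ + R₂ →
      ρ * (min R₁ (min R₂ H) - δ) ≤ B) → ρ * min R₁ (min R₂ H) ≤ B := by
    intro hR B hB
    refine le_of_forall_pos_le_add fun ε hε => ?_
    set δ := min (ε / ρ) (R₁ + R₂ - H) with hδ
    have hδε : ρ * δ ≤ ε := by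
      calc ρ * δ ≤ ρ * (ε / ρ) := by gcongr; exact min_le_left _ _
        _ = ε := by field_simp
    have := hB δ (lt_min (by positivity) (by linarith))
      (by linarith [min_le_right (ε / ρ) (R₁ + R₂ - H)])
    linarith
  refine ⟨fun hR => ⟨⟨?_, ?_⟩, ?_, ?_⟩, fun hR => ⟨?_, ?_⟩⟩
  · rintro E ⟨e, he0, he1, hbob, hE⟩
    exact hub E e he0 he1 hbob hE
  · intro B hB
    refine hsup hR B fun δ hδ hδR => hB ?_
    obtain ⟨e, he0, he1, hbob, hE⟩ := exists_encoders hρ hp0 hp1 hH hR₁ hR₂ hδ hδR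
    exact ⟨e, he0, he1, tendsto_bobGuessAmb_of_bobListAmb hρ hp0 hp1 he0 he1 hbob, hE⟩
  · rintro E ⟨e, he0, he1, hbob, hE⟩
    exact hub E e he0 he1 (tendsto_bobGuessAmb_of_bobListAmb hρ hp0 hp1 he0 he1 hbob) hE
  · intro B hB
    exact hsup hR B fun δ hδ hδR => hB (exists_encoders hρ hp0 hp1 hH hR₁ hR₂ hδ hδR)
  · rintro ⟨e, he0, he1, hbob⟩
    exact hR.not_ge
      (entropyRate_le_of_tendsto_bobGuessAmb hρ hp0 hp1 hH hR₁ hR₂ he0 he1 hbob)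
  · rintro ⟨e, he0, he1, hbob⟩
    exact hR.not_ge (entropyRate_le_of_tendsto_bobGuessAmb hρ hp0 hp1 hH hR₁ hR₂ he0 he1
      (tendsto_bobGuessAmb_of_bobListAmb hρ hp0 hp1 he0 he1 hbob))
end
end

section
/- (Eve must form a list.) Suppose min(|𝒨₁|, |𝒨₂|) ≥ 1 + ⌊log|𝒳|⌋. Then there exists a choice of Alice's encoder for which Bob's list ambiguity satisfies 𝒜_B^l ≤ 1 + 2^{ρ(H_{1/(1+ρ)}(X|Y) − log(|𝒨₁|·|𝒨₂|) + 2·log(1 + ⌊log|𝒳|⌋) + 3)} and Eve's list ambiguity satisfies 𝒜_E^l = E[|L_Y|^ρ] = Σ_y P_Y(y)·|{x ∈ 𝒳 : P_{X|Y}(x|y) > 0}|^ρ. Conversely, for every choice of Alice's encoder, 𝒜_B^l ≥ max( 2^{ρ(H_{1/(1+ρ)}(X|Y) − log(|𝒨₁|·|𝒨₂|))}, 1 ) and 𝒜_E^l ≤ E[|L_Y|^ρ]. -/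
open scoped BigOperators

noncomputable section

/-- Eve's list ambiguity `𝒜_E^l = E[min(|L^Y_{M₁}|, |L^Y_{M₂}|)^ρ]`, where `L^y_{m_k}` is the
set of realizations of `X` of positive posterior probability given `(Y, M_k) = (y, m_k)`. -/
def eveListAmb {𝒳 𝒴 M₁ M₂ : Type*} [Fintype 𝒳] [Fintype 𝒴] [Fintype M₁] [Fintype M₂]
    (ρ : ℝ) (p : 𝒳 → 𝒴 → ℝ) (e : 𝒳 → 𝒴 → M₁ × M₂ → ℝ) : ℝ :=
  ∑ x : 𝒳, ∑ y : 𝒴, ∑ m₁ : M₁, ∑ m₂ : M₂, p x y * e x y (m₁, m₂) *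
    ((min
        ((Finset.univ.filter fun x' : 𝒳 => 0 < p x' y * ∑ n₂ : M₂, e x' y (m₁, n₂)).card)
        ((Finset.univ.filter fun x' : 𝒳 => 0 < p x' y * ∑ n₁ : M₁, e x' y (n₁, m₂)).card)
      : ℕ) : ℝ) ^ ρ

open Finset in
theorem rpow_sum_le_sum_rpow {ι : Type*} (s : Finset ι) (f : ι → ℝ) (hf : ∀ i, 0 ≤ f i)
    {a : ℝ} (ha : 0 < a) (ha1 : a ≤ 1) : (∑ i ∈ s, f i) ^ a ≤ ∑ i ∈ s, f i ^ a := by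
  lift f to ι → NNReal using hf
  beta_reduce
  exact_mod_cast le_sum_of_subadditive (fun x : NNReal => x ^ a) (by simp [ha.ne'])
    (fun x y => NNReal.rpow_add_le_add_rpow x y ha.le ha1) s f

open Finset in
/-- Counting each element of a list of length `L` with weight `1 / L` counts every nonempty list
once. -/
theorem sum_inv_card_le {X M : Type*} [Fintype X] [Fintype M] (w : X → M → ℝ) :
    ∑ i ∈ univ.filter (fun i : X × M => 0 < w i.1 i.2),
      ((#{x | 0 < w x i.2} : ℕ) : ℝ)⁻¹ ≤ Fintype.card M := by
  rw [sum_filter, Fintype.sum_prod_type_right, Fintype.card_eq_sum_ones]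
  push_cast
  refine sum_le_sum fun m _ => ?_
  rw [← sum_filter]
  simp only [sum_const, nsmul_eq_mul]
  exact mul_inv_le_one

open Finset in
/-- The converse bound for list encoding of a (sub-)distribution `q` with hints in `M`. -/
theorem rpow_sum_rpow_le_list {X M : Type*} [Fintype X] [Fintype M] {ρ : ℝ} (hρ : 0 < ρ)
    (q : X → ℝ) (hq : ∀ x, 0 ≤ q x) (e : X → M → ℝ) (he : ∀ x m, 0 ≤ e x m)
    (he1 : ∀ x, ∑ m, e x m = 1) :
    (∑ x, q x ^ (1 / (1 + ρ))) ^ (1 + ρ) ≤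
      (Fintype.card M : ℝ) ^ ρ *
        ∑ x, ∑ m, q x * e x m * ((#{x' | 0 < q x' * e x' m} : ℕ) : ℝ) ^ ρ := by
  set α := 1 / (1 + ρ) with hα
  have h1ρ : 0 < 1 + ρ := by linarith
  have hα0 : 0 < α := by positivity
  have hα1 : α ≤ 1 := by rw [hα, div_le_one h1ρ]; linarith
  set w : X → M → ℝ := fun x m => q x * e x m with hw
  have hw0 : ∀ x m, 0 ≤ w x m := fun x m => mul_nonneg (hq x) (he x m)
  set L : M → ℝ := fun m => ((#{x' | 0 < w x' m} : ℕ) : ℝ) with hL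
  have hL0 : ∀ m, 0 ≤ L m := fun m => Nat.cast_nonneg _
  set s : Finset (X × M) := univ.filter (fun i => 0 < w i.1 i.2) with hs
  have hLpos : ∀ i ∈ s, 0 < L i.2 := by
    intro i hi
    simp only [hL, Nat.cast_pos, card_pos]
    exact ⟨i.1, by simpa [hs] using hi⟩
  have hsplit : ∑ x, q x ^ α ≤ ∑ i ∈ s, w i.1 i.2 ^ α := by
    calc ∑ x, q x ^ α = ∑ x, (∑ m, w x m) ^ α := by
          simp only [hw, ← mul_sum, he1, mul_one]
      _ ≤ ∑ x, ∑ m, w x m ^ α :=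
          sum_le_sum fun x _ => rpow_sum_le_sum_rpow _ _ (hw0 x) hα0 hα1
      _ = ∑ i : X × M, w i.1 i.2 ^ α := by rw [Fintype.sum_prod_type]
      _ = ∑ i ∈ s, w i.1 i.2 ^ α := by
          refine (sum_subset (subset_univ s) fun i _ hi => ?_).symm
          have : w i.1 i.2 = 0 := le_antisymm (by simpa [hs] using hi) (hw0 _ _)
          rw [this, Real.zero_rpow hα0.ne']
  have hpq : (1 + ρ).HolderConjugate ((1 + ρ) / ρ) := by
    rw [Real.holderConjugate_iff]
    refine ⟨by linarith, ?_⟩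
    field_simp
  have hHolder := Real.inner_le_Lp_mul_Lq_of_nonneg (s := s)
    (f := fun i => (w i.1 i.2 * L i.2 ^ ρ) ^ α) (g := fun i => (L i.2)⁻¹ ^ (ρ * α)) hpq
    (fun i _ => by have := hw0 i.1 i.2; have := hL0 i.2; positivity)
    (fun i _ => by have := hL0 i.2; positivity)
  have hlhs : ∑ i ∈ s, (w i.1 i.2 * L i.2 ^ ρ) ^ α * (L i.2)⁻¹ ^ (ρ * α) =
      ∑ i ∈ s, w i.1 i.2 ^ α := by
    refine sum_congr rfl fun i hi => ?_
    have := hLpos i hi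
    rw [Real.mul_rpow (hw0 _ _) (by positivity), ← Real.rpow_mul this.le,
      Real.inv_rpow this.le, mul_inv_cancel_right₀ (by positivity)]
  have hfst : ∑ i ∈ s, ((w i.1 i.2 * L i.2 ^ ρ) ^ α) ^ (1 + ρ) =
      ∑ i ∈ s, w i.1 i.2 * L i.2 ^ ρ := by
    refine sum_congr rfl fun i hi => ?_
    have := hLpos i hi
    rw [← Real.rpow_mul (mul_nonneg (hw0 _ _) (by positivity)), hα,
      one_div_mul_cancel h1ρ.ne', Real.rpow_one]
  have hsnd : ∑ i ∈ s, ((L i.2)⁻¹ ^ (ρ * α)) ^ ((1 + ρ) / ρ) = ∑ i ∈ s, (L i.2)⁻¹ := by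
    refine sum_congr rfl fun i hi => ?_
    have := hLpos i hi
    rw [← Real.rpow_mul (by positivity), show ρ * α * ((1 + ρ) / ρ) = 1 by rw [hα]; field_simp,
      Real.rpow_one]
  rw [hlhs, hfst, hsnd] at hHolder
  have hN0 : 0 ≤ ∑ i ∈ s, (L i.2)⁻¹ := sum_nonneg fun i _ => inv_nonneg.2 (hL0 _)
  have hB0 : 0 ≤ ∑ i ∈ s, w i.1 i.2 * L i.2 ^ ρ :=
    sum_nonneg fun i _ => mul_nonneg (hw0 _ _) (Real.rpow_nonneg (hL0 _) _)
  have hB : ∑ i ∈ s, w i.1 i.2 * L i.2 ^ ρ ≤ ∑ x, ∑ m, w x m * L m ^ ρ := by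
    rw [← Fintype.sum_prod_type (f := fun i : X × M => w i.1 i.2 * L i.2 ^ ρ)]
    exact sum_le_sum_of_subset_of_nonneg (subset_univ s)
      fun i _ _ => mul_nonneg (hw0 _ _) (Real.rpow_nonneg (hL0 _) _)
  calc (∑ x, q x ^ α) ^ (1 + ρ)
      ≤ ((∑ i ∈ s, w i.1 i.2 * L i.2 ^ ρ) ^ (1 / (1 + ρ)) *
          (∑ i ∈ s, (L i.2)⁻¹) ^ (1 / ((1 + ρ) / ρ))) ^ (1 + ρ) :=
        Real.rpow_le_rpow (sum_nonneg fun x _ => Real.rpow_nonneg (hq x) _)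
          (hsplit.trans hHolder) h1ρ.le
    _ = (∑ i ∈ s, (L i.2)⁻¹) ^ ρ * ∑ i ∈ s, w i.1 i.2 * L i.2 ^ ρ := by
        rw [Real.mul_rpow (Real.rpow_nonneg hB0 _) (Real.rpow_nonneg hN0 _), ← Real.rpow_mul hB0,
          ← Real.rpow_mul hN0, one_div_mul_cancel h1ρ.ne', Real.rpow_one,
          show 1 / ((1 + ρ) / ρ) * (1 + ρ) = ρ by field_simp, mul_comm]
    _ ≤ _ := by
        exact mul_le_mul (Real.rpow_le_rpow hN0 (sum_inv_card_le w) hρ.le) hB hB0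
          (Real.rpow_nonneg (Nat.cast_nonneg _) _)

/-- The exponential of the Rényi entropy. -/
theorem two_rpow_mul_condRenyi_add {X Y : Type*} [Fintype X] [Fintype Y] {ρ : ℝ} (hρ : 0 < ρ)
    (p : X → Y → ℝ) (hp0 : ∀ x y, 0 ≤ p x y) (hp1 : ∑ x, ∑ y, p x y = 1) (c : ℝ) :
    (2 : ℝ) ^ (ρ * (condRenyi ρ p + c)) =
      (∑ y, (∑ x, p x y ^ (1 / (1 + ρ))) ^ (1 + ρ)) * ((2 : ℝ) ^ c) ^ ρ := by
  have h1ρ : 0 < 1 + ρ := by linarith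
  have hnn : ∀ y, 0 ≤ ∑ x, p x y ^ (1 / (1 + ρ)) :=
    fun y => Finset.sum_nonneg fun x _ => Real.rpow_nonneg (hp0 x y) _
  have hT : 0 < ∑ y, (∑ x, p x y ^ (1 / (1 + ρ))) ^ (1 + ρ) := by
    obtain ⟨x, y, hxy⟩ : ∃ x y, 0 < p x y := by
      by_contra! h
      have : ∑ x, ∑ y, p x y ≤ 0 := Finset.sum_nonpos fun x _ => Finset.sum_nonpos fun y _ => h x y
      linarith
    refine Finset.sum_pos' (fun y _ => Real.rpow_nonneg (hnn y) _) ⟨y, Finset.mem_univ _, ?_⟩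
    refine Real.rpow_pos_of_pos (Finset.sum_pos' (fun x _ => Real.rpow_nonneg (hp0 x y) _)
      ⟨x, Finset.mem_univ _, Real.rpow_pos_of_pos hxy _⟩) _
  have hcoef : ρ * condRenyi ρ p =
      Real.logb 2 (∑ y, (∑ x, p x y ^ (1 / (1 + ρ))) ^ (1 + ρ)) := by
    rw [condRenyi, one_div_one_div, ← mul_assoc,
      show ρ * (1 / (1 + ρ) / (1 - 1 / (1 + ρ))) = 1 by
        rw [one_sub_div h1ρ.ne', add_sub_cancel_left]; field_simp, one_mul]
  rw [mul_add, Real.rpow_add two_pos, hcoef, Real.rpow_logb two_pos (by norm_num) hT, mul_comm ρ c,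
    Real.rpow_mul two_pos.le]

theorem bobListAmb_comm {X Y M₁ M₂ : Type*} [Fintype X] [Fintype Y] [Fintype M₁] [Fintype M₂]
    (ρ : ℝ) (p : X → Y → ℝ) (e : X → Y → M₁ × M₂ → ℝ) :
    bobListAmb ρ p e = ∑ y, ∑ x, ∑ m, p x y * e x y m *
      (((Finset.univ.filter fun x' : X => 0 < p x' y * e x' y m).card : ℝ)) ^ ρ :=
  Finset.sum_comm

theorem one_le_bobListAmb {X Y M₁ M₂ : Type*} [Fintype X] [Fintype Y] [Fintype M₁] [Fintype M₂]
    {ρ : ℝ} (hρ : 0 < ρ) (p : X → Y → ℝ) (hp0 : ∀ x y, 0 ≤ p x y)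
    (hp1 : ∑ x, ∑ y, p x y = 1) (e : X → Y → M₁ × M₂ → ℝ) (he0 : ∀ x y m, 0 ≤ e x y m)
    (he1 : ∀ x y, ∑ m, e x y m = 1) : 1 ≤ bobListAmb ρ p e := by
  calc (1 : ℝ) = ∑ x, ∑ y, ∑ m, p x y * e x y m := by
        simp only [← Finset.mul_sum, he1, mul_one, hp1]
    _ ≤ _ := by
        refine Finset.sum_le_sum fun x _ => Finset.sum_le_sum fun y _ =>
          Finset.sum_le_sum fun m _ => ?_
        rcases (mul_nonneg (hp0 x y) (he0 x y m)).eq_or_lt with h | h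
        · rw [← h, zero_mul]
        · refine le_mul_of_one_le_right h.le (Real.one_le_rpow ?_ hρ.le)
          exact_mod_cast Finset.card_pos.2 ⟨x, by simpa using h⟩

theorem two_rpow_le_bobListAmb {X Y M₁ M₂ : Type*} [Fintype X] [Fintype Y] [Fintype M₁]
    [Fintype M₂] {ρ : ℝ} (hρ : 0 < ρ) (p : X → Y → ℝ) (hp0 : ∀ x y, 0 ≤ p x y)
    (hp1 : ∑ x, ∑ y, p x y = 1) (hM : 0 < Fintype.card M₁ * Fintype.card M₂)
    (e : X → Y → M₁ × M₂ → ℝ) (he0 : ∀ x y m, 0 ≤ e x y m) (he1 : ∀ x y, ∑ m, e x y m = 1) :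
    (2 : ℝ) ^ (ρ * (condRenyi ρ p - Real.logb 2 ((Fintype.card M₁ * Fintype.card M₂ : ℕ) : ℝ))) ≤
      bobListAmb ρ p e := by
  have hM' : (0 : ℝ) < ((Fintype.card M₁ * Fintype.card M₂ : ℕ) : ℝ) := by exact_mod_cast hM
  rw [sub_eq_add_neg, two_rpow_mul_condRenyi_add hρ p hp0 hp1, Real.rpow_neg two_pos.le,
    Real.rpow_logb two_pos (by norm_num) hM', Real.inv_rpow hM'.le,
    ← div_eq_mul_inv, div_le_iff₀' (by positivity), bobListAmb_comm, Finset.mul_sum]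
  refine Finset.sum_le_sum fun y _ => ?_
  rw [← Fintype.card_prod]
  exact rpow_sum_rpow_le_list hρ (fun x => p x y) (fun x => hp0 x y) (fun x => e x y)
    (fun x => he0 x y) (fun x => he1 x y)

theorem eveListAmb_le {X Y M₁ M₂ : Type*} [Fintype X] [Fintype Y] [Fintype M₁] [Fintype M₂]
    {ρ : ℝ} (hρ : 0 < ρ) (p : X → Y → ℝ) (hp0 : ∀ x y, 0 ≤ p x y)
    (e : X → Y → M₁ × M₂ → ℝ) (he0 : ∀ x y m, 0 ≤ e x y m) (he1 : ∀ x y, ∑ m, e x y m = 1) :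
    eveListAmb ρ p e ≤ ∑ y, (∑ x, p x y) *
      (((Finset.univ.filter fun x => 0 < p x y).card : ℝ)) ^ ρ := by
  simp only [Finset.sum_mul]
  rw [Finset.sum_comm (s := (Finset.univ : Finset Y)), eveListAmb]
  refine Finset.sum_le_sum fun x _ => Finset.sum_le_sum fun y _ => ?_
  calc _ ≤ ∑ m₁, ∑ m₂, p x y * e x y (m₁, m₂) *
        (((Finset.univ.filter fun x => 0 < p x y).card : ℝ)) ^ ρ := by
        refine Finset.sum_le_sum fun m₁ _ => Finset.sum_le_sum fun m₂ _ => ?_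
        refine mul_le_mul_of_nonneg_left (Real.rpow_le_rpow (Nat.cast_nonneg _) ?_ hρ.le)
          (mul_nonneg (hp0 x y) (he0 _ _ _))
        refine Nat.cast_le.2 ((min_le_left _ _).trans (Finset.card_le_card fun x' hx' => ?_))
        simp only [Finset.mem_filter, Finset.mem_univ, true_and] at hx' ⊢
        exact pos_of_mul_pos_left hx' (Finset.sum_nonneg fun _ _ => he0 _ _ _)
    _ = _ := by
        simp only [← Finset.sum_mul, ← Finset.mul_sum]
        rw [← Fintype.sum_prod_type (f := e x y), he1, mul_one]

theorem eveListAmb_eq {X Y M₁ M₂ : Type*} [Fintype X] [Fintype Y] [Fintype M₁] [Fintype M₂]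
    (ρ : ℝ) (p : X → Y → ℝ) (e : X → Y → M₁ × M₂ → ℝ) (he1 : ∀ x y, ∑ m, e x y m = 1)
    (h₁ : ∀ x y m₁, 0 < ∑ m₂, e x y (m₁, m₂)) (h₂ : ∀ x y m₂, 0 < ∑ m₁, e x y (m₁, m₂)) :
    eveListAmb ρ p e = ∑ y, (∑ x, p x y) *
      (((Finset.univ.filter fun x => 0 < p x y).card : ℝ)) ^ ρ := by
  simp only [eveListAmb, mul_pos_iff_of_pos_right (h₁ _ _ _), mul_pos_iff_of_pos_right (h₂ _ _ _),
    min_self, ← Finset.sum_mul, ← Finset.mul_sum]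
  simp only [← Fintype.sum_prod_type, he1, mul_one, Finset.sum_mul]
  exact Finset.sum_comm

open Finset in
/-- The elements of a finite type can be ranked by decreasing values of `q`. -/
theorem exists_rank {X : Type*} [Fintype X] (q : X → ℝ) :
    ∃ r : X → ℕ, Function.Injective r ∧ (∀ x, 0 < r x) ∧ ∀ x, r x ≤ #{x' | q x ≤ q x'} := by
  set key : X → ℝ ×ₗ Fin (Fintype.card X) := fun x => toLex (-q x, Fintype.equivFin X x) with hkey
  have hinj : Function.Injective key := by
    intro x z h
    have h' := congrArg ofLex h
    simp only [hkey, ofLex_toLex, Prod.mk.injEq, EmbeddingLike.apply_eq_iff_eq] at h'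
    exact h'.2
  have hmono : ∀ x z, key x < key z → #{x' | key x' ≤ key x} < #{x' | key x' ≤ key z} := by
    intro x z h
    refine card_lt_card (ssubset_iff_of_subset (fun t ht => ?_) |>.2 ⟨z, by simp, by simpa using h⟩)
    simp only [mem_filter, mem_univ, true_and] at ht ⊢
    exact ht.trans h.le
  refine ⟨fun x => #{x' | key x' ≤ key x}, fun x z h => ?_, fun x => ?_, fun x => ?_⟩
  · by_contra hne
    rcases lt_or_gt_of_ne (hinj.ne hne) with h' | h'
    · exact (hmono _ _ h').ne h
    · exact (hmono _ _ h').ne' h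
  · exact card_pos.2 ⟨x, by simp⟩
  · refine card_le_card fun t ht => ?_
    simp only [mem_filter, mem_univ, true_and, hkey, Prod.Lex.toLex_le_toLex'] at ht ⊢
    linarith [ht.1]

open Finset in
/-- Arikan's bound on the moments of the rank. -/
theorem sum_mul_rank_rpow_le {X : Type*} [Fintype X] {ρ : ℝ} (hρ : 0 < ρ) (q : X → ℝ)
    (hq : ∀ x, 0 ≤ q x) (r : X → ℕ) (hr : ∀ x, r x ≤ #{x' | q x ≤ q x'}) :
    ∑ x, q x * (r x : ℝ) ^ ρ ≤ (∑ x, q x ^ (1 / (1 + ρ))) ^ (1 + ρ) := by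
  have h1ρ : 0 < 1 + ρ := by linarith
  have hα0 : 0 < 1 / (1 + ρ) := by positivity
  set α := 1 / (1 + ρ) with hα
  set S := ∑ x, q x ^ α with hS
  have hS0 : 0 ≤ S := sum_nonneg fun x _ => Real.rpow_nonneg (hq x) _
  have key : ∀ x, q x * (r x : ℝ) ^ ρ ≤ q x ^ α * S ^ ρ := by
    intro x
    rcases (hq x).eq_or_lt with h | h
    · rw [← h, Real.zero_rpow hα0.ne', zero_mul, zero_mul]
    have hrS : q x ^ α * (r x : ℝ) ≤ S := by
      calc q x ^ α * (r x : ℝ) ≤ q x ^ α * (#{x' | q x ≤ q x'} : ℕ) :=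
            mul_le_mul_of_nonneg_left (Nat.cast_le.2 (hr x)) (by positivity)
        _ = ∑ x' ∈ univ.filter (fun x' => q x ≤ q x'), q x ^ α := by
            rw [sum_const, nsmul_eq_mul, mul_comm]
        _ ≤ ∑ x' ∈ univ.filter (fun x' => q x ≤ q x'), q x' ^ α :=
            sum_le_sum fun x' hx' => Real.rpow_le_rpow h.le (by simpa using hx') hα0.le
        _ ≤ S := sum_le_sum_of_subset_of_nonneg (subset_univ _)
            fun x' _ _ => Real.rpow_nonneg (hq x') _
    calc q x * (r x : ℝ) ^ ρ = q x ^ α * (q x ^ α * (r x : ℝ)) ^ ρ := by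
          rw [Real.mul_rpow (by positivity) (by positivity), ← Real.rpow_mul h.le, ← mul_assoc,
            ← Real.rpow_add h, show α + α * ρ = 1 by rw [hα]; field_simp, Real.rpow_one]
      _ ≤ q x ^ α * S ^ ρ := by gcongr
  calc _ ≤ ∑ x, q x ^ α * S ^ ρ := sum_le_sum fun x _ => key x
    _ = S ^ (1 + ρ) := by
      rw [← sum_mul, ← hS, Real.rpow_add_of_nonneg hS0 zero_le_one hρ.le, Real.rpow_one]

/-- Ranks are described by the dyadic interval they lie in and a residue modulo `c` of their
position in that interval. -/
def rankCell (c n : ℕ) : ℕ × ℕ := (Nat.log 2 n, (n - 2 ^ Nat.log 2 n) % c)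

open Finset in
theorem card_rankCell_le {X : Type*} [Fintype X] (c : ℕ) (r : X → ℕ)
    (hr : Function.Injective r) (hr0 : ∀ x, 0 < r x) (x : X) :
    #{x' | rankCell c (r x') = rankCell c (r x)} ≤ (r x - 1) / c + 1 := by
  rw [← card_range ((r x - 1) / c + 1)]
  refine card_le_card_of_injOn (fun x' => (r x' - 2 ^ Nat.log 2 (r x')) / c) ?_ ?_
  · intro x' hx'
    simp only [rankCell, Prod.mk.injEq, coe_filter, mem_univ, true_and, Set.mem_ofPred_eq] at hx'
    simp only [coe_range, Set.mem_Iio, Nat.lt_succ_iff]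
    refine Nat.div_le_div_right ?_
    have h1 := Nat.lt_pow_succ_log_self one_lt_two (r x')
    have h2 := Nat.pow_log_le_self 2 (hr0 x).ne'
    rw [hx'.1] at h1 ⊢
    rw [pow_succ] at h1
    omega
  · intro x₁ h₁ x₂ h₂ h
    simp only [rankCell, Prod.mk.injEq, coe_filter, mem_univ, true_and, Set.mem_ofPred_eq] at h₁ h₂ h
    apply hr
    have h3 := Nat.div_add_mod (r x₁ - 2 ^ Nat.log 2 (r x₁)) c
    have h4 := Nat.div_add_mod (r x₂ - 2 ^ Nat.log 2 (r x₂)) c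
    rw [h, h₁.2] at h3
    rw [h₂.2] at h4
    have h5 := Nat.pow_log_le_self 2 (hr0 x₁).ne'
    have h6 := Nat.pow_log_le_self 2 (hr0 x₂).ne'
    have h7 : 2 ^ Nat.log 2 (r x₁) = 2 ^ Nat.log 2 (r x₂) := by rw [h₁.1, h₂.1]
    omega

theorem rpow_ceil_add_le {ρ : ℝ} (hρ : 0 < ρ) {c n : ℕ} (hc : 0 < c) (hn : 0 < n) :
    (((n - 1) / c + 1 : ℕ) : ℝ) ^ ρ + min 1 ((2 / c : ℝ) ^ ρ) ≤ 1 + (2 * n / c : ℝ) ^ ρ := by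
  have hc' : (0 : ℝ) < c := by exact_mod_cast hc
  have hn' : (1 : ℝ) ≤ n := by exact_mod_cast hn
  rcases le_or_gt n c with h | h
  · rw [Nat.div_eq_of_lt (by omega)]
    have : (2 / c : ℝ) ^ ρ ≤ (2 * n / c : ℝ) ^ ρ := by
      gcongr
      linarith
    have := min_le_right (1 : ℝ) ((2 / c : ℝ) ^ ρ)
    simp only [zero_add, Nat.cast_one, Real.one_rpow]
    linarith
  · have h1 : (((n - 1) / c + 1 : ℕ) : ℝ) ≤ 2 * n / c := by
      have h2 : (((n - 1) / c : ℕ) : ℝ) ≤ ((n - 1 : ℕ) : ℝ) / c := Nat.cast_div_le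
      have h3 : ((n - 1 : ℕ) : ℝ) ≤ n := by exact_mod_cast Nat.sub_le n 1
      have h4 : (1 : ℝ) ≤ n / c := by
        rw [one_le_div hc']
        exact_mod_cast h.le
      have h5 : ((n - 1 : ℕ) : ℝ) / c ≤ n / c := by gcongr
      push_cast
      rw [mul_div_assoc]
      linarith
    have := Real.rpow_le_rpow (Nat.cast_nonneg _) h1 hρ.le
    have := min_le_left (1 : ℝ) ((2 / c : ℝ) ^ ρ)
    linarith

open Finset in
/-- If Alice sends the hint `g x y` except with probability `ε`, when she draws it from a
distribution `u` that avoids the range of `g`, then only the fibres of `g` matter to Bob, up to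
a term of order `ε`. -/
theorem bobListAmb_le_of_mixture {X Y M₁ M₂ : Type*} [Fintype X] [Fintype Y] [Fintype M₁]
    [Fintype M₂] [DecidableEq (M₁ × M₂)] {ρ : ℝ} (hρ : 0 < ρ) (p : X → Y → ℝ)
    (hp0 : ∀ x y, 0 ≤ p x y) (g : X → Y → M₁ × M₂)
    (u : M₁ × M₂ → ℝ) (hu0 : ∀ m, 0 ≤ u m) (hu1 : ∑ m, u m = 1) (hug : ∀ x y, u (g x y) = 0)
    {ε : ℝ} (hε0 : 0 ≤ ε) (N : X → Y → ℕ)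
    (hN : ∀ x y, #{x' | g x' y = g x y} ≤ N x y) :
    bobListAmb ρ p (fun x y m => (1 - ε) * (if m = g x y then 1 else 0) + ε * u m) ≤
      ∑ x, ∑ y, p x y * ((N x y : ℝ) ^ ρ + ε * (Fintype.card X : ℝ) ^ ρ) := by
  refine sum_le_sum fun x _ => sum_le_sum fun y _ => ?_
  have hterm : ∀ m, p x y * ((1 - ε) * (if m = g x y then 1 else 0) + ε * u m) *
      ((#{x' | 0 < p x' y * ((1 - ε) * (if m = g x' y then 1 else 0) + ε * u m)} : ℕ) : ℝ) ^ ρ ≤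
      p x y * ((if m = g x y then (N x y : ℝ) ^ ρ else 0) +
        ε * u m * (Fintype.card X : ℝ) ^ ρ) := by
    intro m
    rw [mul_assoc]
    refine mul_le_mul_of_nonneg_left ?_ (hp0 x y)
    split_ifs with h
    · subst h
      have hle : ((#{x' | 0 < p x' y * ((1 - ε) * (if g x y = g x' y then 1 else 0) +
          ε * u (g x y))} : ℕ) : ℝ) ≤ N x y := by
        refine Nat.cast_le.2 ((card_le_card fun x' hx' => ?_).trans (hN x y))
        simp only [mem_filter, mem_univ, true_and, hug, mul_zero, add_zero] at hx' ⊢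
        by_contra hne
        rw [if_neg (Ne.symm hne)] at hx'
        simp at hx'
      rw [hug] at hle ⊢
      have := Real.rpow_le_rpow (Nat.cast_nonneg _) hle hρ.le
      simp only [mul_one, mul_zero, add_zero, zero_mul] at this ⊢
      exact (mul_le_of_le_one_left (Real.rpow_nonneg (Nat.cast_nonneg _) _) (by linarith)).trans
        this
    · simp only [mul_zero, zero_add]
      refine mul_le_mul_of_nonneg_left (Real.rpow_le_rpow (Nat.cast_nonneg _) ?_ hρ.le)
        (mul_nonneg hε0 (hu0 m))
      exact_mod_cast card_le_univ _
  refine (sum_le_sum fun m _ => hterm m).trans_eq ?_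
  rw [← mul_sum, sum_add_distrib, sum_ite_eq' univ, if_pos (mem_univ _), ← sum_mul, ← mul_sum, hu1,
    mul_one]

open Finset in
/-- A uniform distribution on the union of a row and a column. -/
theorem exists_cross_distribution {M₁ M₂ : Type*} [Fintype M₁] [Fintype M₂] (a : M₁) (b : M₂) :
    ∃ u : M₁ × M₂ → ℝ, (∀ m, 0 ≤ u m) ∧ ∑ m, u m = 1 ∧ (∀ m₁, 0 < u (m₁, b)) ∧
      (∀ m₂, 0 < u (a, m₂)) ∧ ∀ m, m.1 ≠ a → m.2 ≠ b → u m = 0 := by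
  classical
  set J : Finset (M₁ × M₂) := univ.filter fun m => m.1 = a ∨ m.2 = b with hJ
  have hJ0 : (0 : ℝ) < #J := by
    exact_mod_cast card_pos.2 ⟨(a, b), by simp [hJ]⟩
  refine ⟨fun m => if m ∈ J then (#J : ℝ)⁻¹ else 0, fun m => ?_, ?_, fun m₁ => ?_, fun m₂ => ?_,
    fun m h₁ h₂ => ?_⟩
  · positivity
  · rw [sum_ite_mem, univ_inter, sum_const, nsmul_eq_mul, mul_inv_cancel₀ hJ0.ne']
  · simpa [hJ] using hJ0
  · simpa [hJ] using hJ0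
  · simp [hJ, h₁, h₂]

/-- With `c` residues per dyadic interval of ranks, Alice can describe `X` to Bob while
revealing nothing about the support of `X` through a single hint. -/
theorem exists_encoder_of_mul_le {X Y M₁ M₂ : Type*} [Fintype X] [Fintype Y] [Fintype M₁]
    [Fintype M₂] [Nonempty M₁] [Nonempty M₂] {ρ : ℝ} (hρ : 0 < ρ) (p : X → Y → ℝ)
    (hp0 : ∀ x y, 0 ≤ p x y) (hp1 : ∑ x, ∑ y, p x y = 1) {c : ℕ} (hc : 0 < c)
    (hcM : (1 + Nat.log 2 (Fintype.card X)) * c ≤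
      (Fintype.card M₁ - 1) * (Fintype.card M₂ - 1)) :
    ∃ e : X → Y → M₁ × M₂ → ℝ,
      (∀ x y m, 0 ≤ e x y m) ∧ (∀ x y, ∑ m, e x y m = 1) ∧
      bobListAmb ρ p e ≤
        1 + (∑ y, (∑ x, p x y ^ (1 / (1 + ρ))) ^ (1 + ρ)) * (2 / c : ℝ) ^ ρ ∧
      eveListAmb ρ p e = ∑ y, (∑ x, p x y) *
        (((Finset.univ.filter fun x => 0 < p x y).card : ℝ)) ^ ρ := by
  classical
  obtain ⟨a⟩ := ‹Nonempty M₁›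
  obtain ⟨b⟩ := ‹Nonempty M₂›
  obtain ⟨u, hu0, hu1, hub, hua, hu⟩ := exists_cross_distribution a b
  choose r hrinj hr0 hr using fun y => exists_rank fun x => p x y
  have hc' : (0 : ℝ) < c := by exact_mod_cast hc
  set K := 1 + Nat.log 2 (Fintype.card X) with hK
  obtain ⟨φ⟩ : Nonempty (Fin K × Fin c ↪ {m // m ≠ a} × {m // m ≠ b}) :=
    Function.Embedding.nonempty_of_card_le (by simpa using hcM)
  have hlog : ∀ x y, Nat.log 2 (r y x) < K := fun x y => by
    rw [hK, Nat.lt_one_add_iff]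
    exact Nat.log_mono_right ((hr y x).trans (Finset.card_le_univ _))
  set cell : X → Y → Fin K × Fin c := fun x y =>
    (⟨(rankCell c (r y x)).1, hlog x y⟩, ⟨(rankCell c (r y x)).2, Nat.mod_lt _ hc⟩) with hcell
  set g : X → Y → M₁ × M₂ := fun x y => ((φ (cell x y)).1, (φ (cell x y)).2) with hg
  have hgcell : ∀ x x' y, g x' y = g x y → rankCell c (r y x') = rankCell c (r y x) := by
    intro x x' y h
    have h' : φ (cell x' y) = φ (cell x y) :=
      Prod.ext (Subtype.ext (congrArg Prod.fst h)) (Subtype.ext (congrArg Prod.snd h))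
    have h'' := φ.injective h'
    exact Prod.ext (congrArg (fun i => i.1.1) h'') (congrArg (fun i => i.2.1) h'')
  have hN : ∀ x y, (Finset.univ.filter fun x' => g x' y = g x y).card ≤ (r y x - 1) / c + 1 := by
    intro x y
    refine (Finset.card_le_card fun x' hx' => ?_).trans
      (card_rankCell_le c (r y) (hrinj y) (hr0 y) x)
    simp only [Finset.mem_filter, Finset.mem_univ, true_and] at hx' ⊢
    exact hgcell _ _ _ hx'
  set A : ℝ := (Fintype.card X : ℝ) ^ ρ with hA
  have hA0 : 0 ≤ A := Real.rpow_nonneg (Nat.cast_nonneg _) _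
  set δ : ℝ := min 1 ((2 / c : ℝ) ^ ρ) with hδ
  have hδ0 : 0 < δ := lt_min one_pos (by positivity)
  set ε : ℝ := δ / (1 + A) with hε
  have hε0 : 0 < ε := by positivity
  have hε1 : ε ≤ 1 := by
    rw [hε, div_le_one (by positivity)]
    linarith [min_le_left (1 : ℝ) ((2 / c : ℝ) ^ ρ)]
  have hεA : ε * A ≤ δ := by
    rw [hε, div_mul_eq_mul_div, div_le_iff₀ (by positivity)]
    nlinarith
  have he0 : ∀ x y m, 0 ≤ (1 - ε) * (if m = g x y then 1 else 0) + ε * u m := by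
    intro x y m
    have := hu0 m
    have := sub_nonneg.2 hε1
    positivity
  have hpos : ∀ x y m, 0 < u m → 0 < (1 - ε) * (if m = g x y then 1 else 0) + ε * u m := by
    intro x y m hm
    have := sub_nonneg.2 hε1
    positivity
  have he1 : ∀ x y, ∑ m, ((1 - ε) * (if m = g x y then 1 else 0) + ε * u m) = 1 := by
    intro x y
    rw [Finset.sum_add_distrib, ← Finset.mul_sum, ← Finset.mul_sum, hu1]
    simp
  refine ⟨fun x y m => (1 - ε) * (if m = g x y then 1 else 0) + ε * u m, he0, he1, ?_, ?_⟩
  · refine (bobListAmb_le_of_mixture hρ p hp0 g u hu0 hu1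
      (fun x y => hu _ (φ (cell x y)).1.2 (φ (cell x y)).2.2) hε0.le _ hN).trans ?_
    calc _ ≤ ∑ x, ∑ y, p x y * (1 + (2 * (r y x) / c : ℝ) ^ ρ) := by
          refine Finset.sum_le_sum fun x _ => Finset.sum_le_sum fun y _ =>
            mul_le_mul_of_nonneg_left ?_ (hp0 x y)
          linarith [rpow_ceil_add_le hρ hc (hr0 y x)]
      _ = 1 + (∑ y, ∑ x, p x y * (r y x : ℝ) ^ ρ) * (2 / c : ℝ) ^ ρ := by
          simp only [mul_add, mul_one, Finset.sum_add_distrib, hp1]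
          rw [Finset.sum_comm, Finset.sum_mul]
          congr 1
          refine Finset.sum_congr rfl fun y _ => ?_
          rw [Finset.sum_mul]
          refine Finset.sum_congr rfl fun x _ => ?_
          rw [mul_assoc, ← Real.mul_rpow (Nat.cast_nonneg _) (by positivity), mul_comm 2,
            mul_div_assoc]
      _ ≤ _ := by
          gcongr with y _
          exact sum_mul_rank_rpow_le hρ _ (fun x => hp0 x y) _ (hr y)
  · refine eveListAmb_eq ρ p _ he1 (fun x y m₁ => ?_) (fun x y m₂ => ?_)
    · exact Finset.sum_pos' (fun m₂ _ => he0 x y _) ⟨b, Finset.mem_univ _, hpos x y _ (hub m₁)⟩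
    · exact Finset.sum_pos' (fun m₁ _ => he0 x y _) ⟨a, Finset.mem_univ _, hpos x y _ (hua m₂)⟩

/-- A uniformly drawn hint reveals nothing to anybody. -/
theorem exists_encoder_bobListAmb_le_card {X Y M₁ M₂ : Type*} [Fintype X] [Fintype Y] [Fintype M₁]
    [Fintype M₂] [Nonempty M₁] [Nonempty M₂] {ρ : ℝ} (hρ : 0 < ρ) (p : X → Y → ℝ)
    (hp0 : ∀ x y, 0 ≤ p x y) (hp1 : ∑ x, ∑ y, p x y = 1) :
    ∃ e : X → Y → M₁ × M₂ → ℝ,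
      (∀ x y m, 0 ≤ e x y m) ∧ (∀ x y, ∑ m, e x y m = 1) ∧
      bobListAmb ρ p e ≤ (Fintype.card X : ℝ) ^ ρ ∧
      eveListAmb ρ p e = ∑ y, (∑ x, p x y) *
        (((Finset.univ.filter fun x => 0 < p x y).card : ℝ)) ^ ρ := by
  have hv : (0 : ℝ) < (Fintype.card (M₁ × M₂) : ℝ)⁻¹ := by
    have : 0 < Fintype.card (M₁ × M₂) := Fintype.card_pos
    positivity
  have he1 : ∀ (_ : X) (_ : Y), ∑ _m : M₁ × M₂, (Fintype.card (M₁ × M₂) : ℝ)⁻¹ = 1 := by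
    intro _ _
    rw [Finset.sum_const, Finset.card_univ, nsmul_eq_mul, mul_inv_cancel₀ (inv_pos.1 hv).ne']
  refine ⟨fun _ _ _ => (Fintype.card (M₁ × M₂) : ℝ)⁻¹, fun _ _ _ => hv.le, he1, ?_,
    eveListAmb_eq ρ p _ he1 (fun _ _ _ => Finset.sum_pos (fun _ _ => hv) Finset.univ_nonempty)
      (fun _ _ _ => Finset.sum_pos (fun _ _ => hv) Finset.univ_nonempty)⟩
  calc _ ≤ ∑ x, ∑ y, ∑ m : M₁ × M₂, p x y * (Fintype.card (M₁ × M₂) : ℝ)⁻¹ *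
        (Fintype.card X : ℝ) ^ ρ := by
        refine Finset.sum_le_sum fun x _ => Finset.sum_le_sum fun y _ =>
          Finset.sum_le_sum fun m _ => mul_le_mul_of_nonneg_left
            (Real.rpow_le_rpow (Nat.cast_nonneg _) (Nat.cast_le.2 (Finset.card_le_univ _)) hρ.le)
            (mul_nonneg (hp0 x y) hv.le)
    _ = (Fintype.card X : ℝ) ^ ρ := by
        have hm : ∀ x y, ∑ m : M₁ × M₂, p x y * (Fintype.card (M₁ × M₂) : ℝ)⁻¹ = p x y := by
          intro x y
          rw [← Finset.mul_sum, he1 x y, mul_one]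
        simp only [← Finset.sum_mul, hm, hp1, one_mul]

theorem one_le_sum_rpow_sum_rpow {X Y : Type*} [Fintype X] [Fintype Y] {ρ : ℝ} (hρ : 0 < ρ)
    (p : X → Y → ℝ) (hp0 : ∀ x y, 0 ≤ p x y) (hp1 : ∑ x, ∑ y, p x y = 1) :
    1 ≤ ∑ y, (∑ x, p x y ^ (1 / (1 + ρ))) ^ (1 + ρ) := by
  calc (1 : ℝ) = ∑ y, ∑ x, p x y := by rw [← hp1, Finset.sum_comm]
    _ ≤ _ := ?_
  refine Finset.sum_le_sum fun y _ => ?_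
  have h := sum_mul_rank_rpow_le hρ (fun x => p x y) (fun x => hp0 x y) (fun _ => 1)
    (fun x => Finset.card_pos.2 ⟨x, by simp⟩)
  simpa using h

/-- Numerology for splitting `(m₁ - 1) * (m₂ - 1)` hint pairs into `k` groups. -/
theorem exists_residue_count {k m₁ m₂ : ℕ} (hk : 2 ≤ k) (h₁ : k ≤ m₁) (h₂ : k ≤ m₂)
    (h : ¬(k = 2 ∧ m₁ = 2 ∧ m₂ = 2)) :
    ∃ c, 0 < c ∧ k * c ≤ (m₁ - 1) * (m₂ - 1) ∧ m₁ * m₂ ≤ 4 * k ^ 2 * c := by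
  obtain ⟨a, rfl⟩ : ∃ a, m₁ = a + 1 := ⟨m₁ - 1, by omega⟩
  obtain ⟨b, rfl⟩ : ∃ b, m₂ = b + 1 := ⟨m₂ - 1, by omega⟩
  simp only [Nat.add_sub_cancel]
  have hkG : k ≤ a * b := by
    rcases hk.eq_or_lt with rfl | hk3
    · have : 2 ≤ a ∨ 2 ≤ b := by omega
      rcases this with h' | h' <;> nlinarith
    · have : 2 ≤ a := by omega
      nlinarith
  have hc : 0 < a * b / k := Nat.div_pos hkG (by omega)
  refine ⟨a * b / k, hc, Nat.mul_div_le _ _, ?_⟩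
  have h3 : a * b < k * (a * b / k + 1) := Nat.lt_mul_div_succ _ (by omega)
  set c := a * b / k
  have h4 : (a + 1) * (b + 1) ≤ 4 * (a * b) := by
    have : 1 ≤ a := by omega
    have : 1 ≤ b := by omega
    nlinarith
  have h5 : k * (c + 1) ≤ 2 * (k * c) := by nlinarith
  have h6 : 2 * (k * c) ≤ k ^ 2 * c := by
    rw [pow_two, mul_assoc]
    exact Nat.mul_le_mul_right _ hk
  nlinarith

/-- Theorem 8: when Eve must form a list, perfect secrecy is almost free. -/
theorem eve_must_form_a_list
    {𝒳 𝒴 M₁ M₂ : Type*} [Fintype 𝒳] [Fintype 𝒴] [Fintype M₁] [Fintype M₂]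
    (ρ : ℝ) (hρ : 0 < ρ)
    (p : 𝒳 → 𝒴 → ℝ) (hp0 : ∀ x y, 0 ≤ p x y) (hp1 : ∑ x : 𝒳, ∑ y : 𝒴, p x y = 1)
    (hM : 1 + Nat.log 2 (Fintype.card 𝒳) ≤ min (Fintype.card M₁) (Fintype.card M₂)) :
    (∃ e : 𝒳 → 𝒴 → M₁ × M₂ → ℝ,
      (∀ x y m, 0 ≤ e x y m) ∧ (∀ x y, ∑ m : M₁ × M₂, e x y m = 1) ∧
      bobListAmb ρ p e ≤
        1 + (2 : ℝ) ^ (ρ * (condRenyi ρ p -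
          Real.logb 2 ((Fintype.card M₁ * Fintype.card M₂ : ℕ) : ℝ) +
          2 * Real.logb 2 ((1 + Nat.log 2 (Fintype.card 𝒳) : ℕ) : ℝ) + 3)) ∧
      eveListAmb ρ p e =
        ∑ y : 𝒴, (∑ x : 𝒳, p x y) *
          (((Finset.univ.filter fun x : 𝒳 => 0 < p x y).card : ℝ)) ^ ρ) ∧
    (∀ e : 𝒳 → 𝒴 → M₁ × M₂ → ℝ,
      (∀ x y m, 0 ≤ e x y m) → (∀ x y, ∑ m : M₁ × M₂, e x y m = 1) →
      bobListAmb ρ p e ≥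
        max ((2 : ℝ) ^ (ρ * (condRenyi ρ p -
          Real.logb 2 ((Fintype.card M₁ * Fintype.card M₂ : ℕ) : ℝ)))) 1 ∧
      eveListAmb ρ p e ≤
        ∑ y : 𝒴, (∑ x : 𝒳, p x y) *
          (((Finset.univ.filter fun x : 𝒳 => 0 < p x y).card : ℝ)) ^ ρ) := by
  have hX : Nonempty 𝒳 := by
    by_contra h
    rw [not_nonempty_iff] at h
    simp at hp1
  set N := Fintype.card 𝒳 with hN
  have hNpos : 0 < N := Fintype.card_pos
  obtain ⟨h₁, h₂⟩ := le_min_iff.1 hM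
  have hM₁ : Nonempty M₁ := Fintype.card_pos_iff.1 (by omega)
  have hM₂ : Nonempty M₂ := Fintype.card_pos_iff.1 (by omega)
  have hMpos : 0 < Fintype.card M₁ * Fintype.card M₂ := Nat.mul_pos (by omega) (by omega)
  refine ⟨?_, fun e he0 he1 => ⟨max_le (two_rpow_le_bobListAmb hρ p hp0 hp1 hMpos e he0 he1)
    (one_le_bobListAmb hρ p hp0 hp1 e he0 he1), eveListAmb_le hρ p hp0 e he0 he1⟩⟩
  set K := 1 + Nat.log 2 N with hK
  have hKR : (0 : ℝ) < (K : ℝ) := by exact_mod_cast (by omega : 0 < K)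
  have hMR : (0 : ℝ) < ((Fintype.card M₁ * Fintype.card M₂ : ℕ) : ℝ) := by exact_mod_cast hMpos
  have hrhs : (2 : ℝ) ^ (ρ * (condRenyi ρ p -
      Real.logb 2 ((Fintype.card M₁ * Fintype.card M₂ : ℕ) : ℝ) +
      2 * Real.logb 2 (K : ℝ) + 3)) =
      (∑ y, (∑ x, p x y ^ (1 / (1 + ρ))) ^ (1 + ρ)) *
        (8 * (K : ℝ) ^ 2 / ((Fintype.card M₁ * Fintype.card M₂ : ℕ) : ℝ)) ^ ρ := by
    rw [show condRenyi ρ p - Real.logb 2 ((Fintype.card M₁ * Fintype.card M₂ : ℕ) : ℝ) +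
      2 * Real.logb 2 (K : ℝ) + 3 = condRenyi ρ p +
        (3 + Real.logb 2 (K : ℝ) * 2 -
          Real.logb 2 ((Fintype.card M₁ * Fintype.card M₂ : ℕ) : ℝ)) by ring,
      two_rpow_mul_condRenyi_add hρ p hp0 hp1, Real.rpow_sub two_pos, Real.rpow_add two_pos,
      Real.rpow_mul two_pos.le, Real.rpow_logb two_pos (by norm_num) hKR,
      Real.rpow_logb two_pos (by norm_num) hMR]
    norm_num
  rw [hrhs]
  have hT := one_le_sum_rpow_sum_rpow hρ p hp0 hp1
  by_cases htriv : N ≤ 1 ∨ K = 2 ∧ Fintype.card M₁ = 2 ∧ Fintype.card M₂ = 2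
  · obtain ⟨e, he0, he1, hB, hE⟩ :=
      exists_encoder_bobListAmb_le_card (M₁ := M₁) (M₂ := M₂) hρ p hp0 hp1
    refine ⟨e, he0, he1, hB.trans ?_, hE⟩
    rcases htriv with h | ⟨hK2, hc₁, hc₂⟩
    · rw [← hN, show N = 1 by omega, Nat.cast_one, Real.one_rpow]
      exact le_add_of_nonneg_right (by positivity)
    · have hN8 : N ≤ 8 := by
        have := Nat.lt_pow_succ_log_self one_lt_two N
        rw [show Nat.log 2 N = 1 by omega] at this
        omega
      have h8 : (N : ℝ) ^ ρ ≤ 8 ^ ρ :=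
        Real.rpow_le_rpow (Nat.cast_nonneg _) (by exact_mod_cast hN8) hρ.le
      rw [hK2, hc₁, hc₂, show 8 * ((2 : ℕ) : ℝ) ^ 2 / ((2 * 2 : ℕ) : ℝ) = 8 by norm_num]
      have := le_mul_of_one_le_left (Real.rpow_nonneg (by norm_num : (0 : ℝ) ≤ 8) ρ) hT
      linarith
  · push Not at htriv
    have hK2 : 2 ≤ K := by
      have := Nat.log_pos one_lt_two (show 2 ≤ N by omega)
      omega
    obtain ⟨c, hc, hcM, hMc⟩ := exists_residue_count hK2 h₁ h₂ (by tauto)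
    obtain ⟨e, he0, he1, hB, hE⟩ := exists_encoder_of_mul_le hρ p hp0 hp1 hc hcM
    refine ⟨e, he0, he1, hB.trans ?_, hE⟩
    have hc' : (0 : ℝ) < c := by exact_mod_cast hc
    have hMc' : ((Fintype.card M₁ * Fintype.card M₂ : ℕ) : ℝ) ≤ 4 * (K : ℝ) ^ 2 * c := by
      exact_mod_cast hMc
    gcongr 1 + _ * ?_ ^ ρ
    rw [div_le_div_iff₀ hc' hMR]
    linarith
end
end
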